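/- arXiv:2502.14733 — 4 statements merged into one kernel-verified Lean document; each statement's English description precedes it below -/
import Mathlib

section
/- Every obtuse planar convex body is staircase connected. -/
open Set MeasureTheory Bornology
open scoped ENNReal

noncomputable section

/-- `ℝ^d` as Euclidean space. -/
abbrev EucR (d : ℕ) := EuclideanSpace ℝ (Fin d)

/-- The segment from `x` to `y` is parallel to a coordinate axis
(all coordinates except possibly one agree). -/
def IsOrthSeg {d : ℕ} (x y : EucR d) : Prop :=
  ∃ i : Fin d, ∀ j, j ≠ i → x j = y j

/-- `p 0, p 1, …, p n` is an orthogonal polygonal path contained in `S`. -/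
def IsOrthPathIn {d : ℕ} (S : Set (EucR d)) (p : ℕ → EucR d) (n : ℕ) : Prop :=
  ∀ k, k < n → IsOrthSeg (p k) (p (k + 1)) ∧ segment ℝ (p k) (p (k + 1)) ⊆ S

/-- `S` is orthogonally connected. -/
def OrthConnected {d : ℕ} (S : Set (EucR d)) : Prop :=
  ∀ x ∈ S, ∀ y ∈ S, ∃ n : ℕ, ∃ p : ℕ → EucR d,
    p 0 = x ∧ p n = y ∧ IsOrthPathIn S p n

/-- An orthogonal path is a staircase if all edges parallel to the same axis
point in the same direction. -/
def IsStaircaseIn {d : ℕ} (S : Set (EucR d)) (p : ℕ → EucR d) (n : ℕ) : Prop :=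
  IsOrthPathIn S p n ∧
    ∀ k, k < n → ∀ l, l < n → ∀ i : Fin d,
      (∀ j, j ≠ i → p k j = p (k + 1) j) → (∀ j, j ≠ i → p l j = p (l + 1) j) →
        0 ≤ (p (k + 1) i - p k i) * (p (l + 1) i - p l i)

/-- `S` is staircase connected. -/
def StaircaseConnected {d : ℕ} (S : Set (EucR d)) : Prop :=
  ∀ x ∈ S, ∀ y ∈ S, ∃ n : ℕ, ∃ p : ℕ → EucR d,
    p 0 = x ∧ p n = y ∧ IsStaircaseIn S p n

/-- `S` is orthogonally convex. -/
def OrthConvex {d : ℕ} (S : Set (EucR d)) : Prop :=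
  ∀ x ∈ S, ∀ y ∈ S, IsOrthSeg x y → segment ℝ x y ⊆ S

/-- A convex body: compact convex with nonempty interior. -/
def IsConvexBody {d : ℕ} (K : Set (EucR d)) : Prop :=
  Convex ℝ K ∧ IsCompact K ∧ (interior K).Nonempty

/-- The point of `ℝ²` with coordinates `(a, b)`. -/
def pt2 (a b : ℝ) : EucR 2 := (WithLp.equiv 2 (Fin 2 → ℝ)).symm ![a, b]

/-- Horizontal width of `S` at `x`: the length of the connected component
containing `x` of the intersection of `S` with the horizontal line through `x`. -/
def hw (S : Set (EucR 2)) (x : EucR 2) : ℝ≥0∞ :=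
  volume (connectedComponentIn {t : ℝ | pt2 t (x 1) ∈ S} (x 0))

/-- Vertical width of `S` at `x`. -/
def vw (S : Set (EucR 2)) (x : EucR 2) : ℝ≥0∞ :=
  volume (connectedComponentIn {t : ℝ | pt2 (x 0) t ∈ S} (x 1))

/-- The set of unit directions from `x` towards points of `K`. -/
def dirSet (x : EucR 2) (K : Set (EucR 2)) : Set (EucR 2) :=
  {u | ∃ y ∈ K, y ≠ x ∧ u = ‖y - x‖⁻¹ • (y - x)}

/-- `α_x(K)`: the angular (1-dimensional Hausdorff) measure of the set of unit
directions from `x` towards other points of `K`. -/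
def angMeasure (x : EucR 2) (K : Set (EucR 2)) : ℝ≥0∞ :=
  μH[1] (dirSet x K)

/-- The half-line from `x` through `y`. -/
def rayFrom (x y : EucR 2) : Set (EucR 2) := {z | ∃ t : ℝ, 0 ≤ t ∧ z = x + t • (y - x)}

/-- `T_x(K)`: the union of the half-lines from `x` through the points of `K \ {x}`. -/
def TCone (x : EucR 2) (K : Set (EucR 2)) : Set (EucR 2) := ⋃ y ∈ K \ {x}, rayFrom x y

/-- `K` is obtuse: at every boundary point `x`, either `α_x(K) > π/2`, or
`α_x(K) = π/2` and `T_x(K) \ {x}` is not open. -/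
def Obtuse (K : Set (EucR 2)) : Prop :=
  ∀ x ∈ frontier K,
    ENNReal.ofReal (Real.pi / 2) < angMeasure x K ∨
      (angMeasure x K = ENNReal.ofReal (Real.pi / 2) ∧ ¬ IsOpen (TCone x K \ {x}))

/-- Inclusion of `ℝ² × ℝ` into `ℝ³`. -/
def incl3 (q : EucR 2) (t : ℝ) : EucR 3 := (WithLp.equiv 2 (Fin 3 → ℝ)).symm ![q 0, q 1, t]

/-- A piece of a continuum `C`: the closure of a connected component of
`C \ {x}` for some cut point `x` of `C`. -/
def IsPiece (C P : Set (EucR 2)) : Prop :=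
  ∃ x ∈ C, ¬ IsPreconnected (C \ {x}) ∧
    ∃ y ∈ C \ {x}, P = closure (connectedComponentIn (C \ {x}) y)

/-- `f` is unimodal on `[a,b]`: non-decreasing on `[a,c]`, non-increasing on `[c,b]`
for some `c ∈ (a,b)`. -/
def Unimodal (f : ℝ → ℝ) (a b : ℝ) : Prop :=
  ∃ c ∈ Ioo a b, MonotoneOn f (Icc a c) ∧ AntitoneOn f (Icc c b)

/-- `a` is an s-extreme point of `M`: it belongs to a staircase in `M` only as an
endpoint. -/
def SExtreme (M : Set (EucR 2)) (a : EucR 2) : Prop :=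
  a ∈ M ∧ ∀ n : ℕ, ∀ γ : ℕ → EucR 2, IsStaircaseIn M γ n →
    a ∈ ⋃ k ∈ Set.Iio n, segment ℝ (γ k) (γ (k + 1)) → a = γ 0 ∨ a = γ n

/-- `M ⊆ ℝ²` is a strip: the preimage of an interval of `ℝ` under a nonzero
linear functional (this includes half-planes and the whole plane). -/
def IsStrip (M : Set (EucR 2)) : Prop :=
  ∃ f : EucR 2 →ₗ[ℝ] ℝ, f ≠ 0 ∧ ∃ I : Set ℝ, I.OrdConnected ∧ M = f ⁻¹' I

end

namespace ObtuseStair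

/-- One axis-parallel, `s`-monotone edge inside `K`. -/
def Step (s : Fin 2 → ℝ) (K : Set (EucR 2)) (a b : EucR 2) : Prop :=
  IsOrthSeg a b ∧ segment ℝ a b ⊆ K ∧ ∀ i, 0 ≤ s i * (b i - a i)

lemma path_of_reach {s : Fin 2 → ℝ} {K : Set (EucR 2)} {x y : EucR 2}
    (h : Relation.ReflTransGen (Step s K) x y) :
    ∃ n : ℕ, ∃ p : ℕ → EucR 2, p 0 = x ∧ p n = y ∧ ∀ k, k < n → Step s K (p k) (p (k + 1)) := by
  induction h with
  | refl => exact ⟨0, fun _ => x, rfl, rfl, fun k hk => absurd hk (Nat.not_lt_zero k)⟩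
  | @tail b c _ hbc ih =>
    obtain ⟨n, p, h0, hn, hp⟩ := ih
    refine ⟨n + 1, fun k => if k ≤ n then p k else c, by simpa using h0, by simp, ?_⟩
    intro k hk
    rcases Nat.lt_succ_iff_lt_or_eq.mp hk with h | h
    · have h1 : k ≤ n := h.le
      have h2 : k + 1 ≤ n := h
      simpa [h1, h2] using hp k h
    · subst h
      simpa [hn] using hbc

lemma stair_of_reach {s : Fin 2 → ℝ} (hs : ∀ i, s i * s i = 1) {K : Set (EucR 2)} {x y : EucR 2}
    (h : Relation.ReflTransGen (Step s K) x y) :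
    ∃ n : ℕ, ∃ p : ℕ → EucR 2, p 0 = x ∧ p n = y ∧ IsStaircaseIn K p n := by
  obtain ⟨n, p, h0, hn, hp⟩ := path_of_reach h
  refine ⟨n, p, h0, hn, fun k hk => ⟨(hp k hk).1, (hp k hk).2.1⟩, ?_⟩
  intro k hk l hl i _ _
  have h1 := mul_nonneg ((hp k hk).2.2 i) ((hp l hl).2.2 i)
  have : s i * (p (k + 1) i - p k i) * (s i * (p (l + 1) i - p l i))
      = (s i * s i) * ((p (k + 1) i - p k i) * (p (l + 1) i - p l i)) := by ring
  rw [this, hs i, one_mul] at h1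
  exact h1

lemma step_flip {s : Fin 2 → ℝ} {K : Set (EucR 2)} {a b : EucR 2}
    (h : Step (fun i => - s i) K a b) : Step s K b a := by
  obtain ⟨⟨i, hi⟩, h2, h3⟩ := h
  refine ⟨⟨i, fun j hj => (hi j hj).symm⟩, by rwa [segment_symm], fun j => ?_⟩
  have := h3 j
  linarith

lemma reach_flip {s : Fin 2 → ℝ} {K : Set (EucR 2)} {a b : EucR 2}
    (h : Relation.ReflTransGen (Step (fun i => - s i) K) a b) :
    Relation.ReflTransGen (Step s K) b a := by
  induction h with
  | refl => exact .refl
  | tail _ hbc ih => exact .head (step_flip hbc) ih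

/-- The cone of feasible directions. -/
def Cn (z : EucR 2) (K : Set (EucR 2)) (d : EucR 2) : Prop := ∃ t : ℝ, 0 < t ∧ z + t • d ∈ K

lemma Cn.smul {z : EucR 2} {K : Set (EucR 2)} (hz : z ∈ K) {d : EucR 2} (h : Cn z K d)
    {a : ℝ} (ha : 0 ≤ a) : Cn z K (a • d) := by
  obtain ⟨t, ht, hK⟩ := h
  rcases ha.eq_or_lt with rfl | ha
  · exact ⟨1, one_pos, by simpa using hz⟩
  · refine ⟨t / a, by positivity, ?_⟩
    rw [smul_smul, div_mul_cancel₀ _ ha.ne']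
    exact hK

lemma Cn.add {z : EucR 2} {K : Set (EucR 2)} (hc : Convex ℝ K) {d e : EucR 2} (h : Cn z K d)
    (h' : Cn z K e) : Cn z K (d + e) := by
  obtain ⟨t, ht, hK⟩ := h
  obtain ⟨r, hr, hK'⟩ := h'
  refine ⟨t * r / (t + r), by positivity, ?_⟩
  have := hc hK hK' (a := r / (t + r)) (b := t / (t + r)) (by positivity) (by positivity)
    (by field_simp; ring)
  convert this using 1
  ext i
  simp
  field_simp
  ring

lemma Cn.of_mem {z w : EucR 2} {K : Set (EucR 2)} (hw : w ∈ K) : Cn z K (w - z) :=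
  ⟨1, one_pos, by simpa using hw⟩

lemma int_dir {K : Set (EucR 2)} {p : EucR 2} (hp : p ∈ interior K) (n : EucR 2) :
    ∃ ε : ℝ, 0 < ε ∧ p + ε • n ∈ K := by
  have h1 : Filter.Tendsto (fun ε : ℝ => p + ε • n) (nhds 0) (nhds p) := by
    have : Continuous (fun ε : ℝ => p + ε • n) := by fun_prop
    simpa using this.tendsto 0
  have h2 : ∀ᶠ ε : ℝ in nhds 0, p + ε • n ∈ K := h1 (mem_interior_iff_mem_nhds.mp hp)
  have h3 : ∀ᶠ ε : ℝ in nhdsWithin 0 (Set.Ioi 0), p + ε • n ∈ K := h2.filter_mono nhdsWithin_le_nhds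
  obtain ⟨ε, h, h'⟩ := (h3.and self_mem_nhdsWithin).exists
  exact ⟨ε, h', h⟩

lemma vec_ext {a b : EucR 2} (h0 : a 0 = b 0) (h1 : a 1 = b 1) : a = b := by
  ext i
  fin_cases i
  · exact h0
  · exact h1

lemma pt2_0 (a b : ℝ) : (pt2 a b) 0 = a := by simp [pt2]
lemma pt2_1 (a b : ℝ) : (pt2 a b) 1 = b := by simp [pt2]

/-- A direction `d` strictly on one side of `y`, outside the open quadrant, yields an axis direction. -/
lemma quad_aux {C : EucR 2 → Prop} (hadd : ∀ d e, C d → C e → C (d + e))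
    (hsm : ∀ d (a : ℝ), 0 ≤ a → C d → C (a • d)) {s : Fin 2 → ℝ} (hs : ∀ i, s i * s i = 1)
    (h0 : ¬ C (pt2 (s 0) 0)) (h1 : ¬ C (pt2 0 (s 1))) {a b : EucR 2} (ha : C a) (hb : C b) :
    (∀ α β : ℝ, 0 ≤ α → 0 ≤ β → α * (s 1 * a 1) + β * (s 1 * b 1) = 0 →
      α * (s 0 * a 0) + β * (s 0 * b 0) ≤ 0) ∧
    (∀ α β : ℝ, 0 ≤ α → 0 ≤ β → α * (s 0 * a 0) + β * (s 0 * b 0) = 0 →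
      α * (s 1 * a 1) + β * (s 1 * b 1) ≤ 0) := by
  have key : ∀ α β : ℝ, 0 ≤ α → 0 ≤ β → C (α • a + β • b) := fun α β hα hβ =>
    hadd _ _ (hsm _ _ hα ha) (hsm _ _ hβ hb)
  constructor
  · intro α β hα hβ h
    by_contra! hc
    apply h0
    set m := α * (s 0 * a 0) + β * (s 0 * b 0) with hm
    have := hsm _ m⁻¹ (by positivity) (key α β hα hβ)
    convert this using 1
    have e1 : α * a 1 + β * b 1 = 0 := by linear_combination s 1 * h - (α * a 1 + β * b 1) * hs 1
    have e0 : α * a 0 + β * b 0 = s 0 * m := by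
      rw [hm]; linear_combination -(α * a 0 + β * b 0) * hs 0
    apply vec_ext
    · simp only [pt2_0, PiLp.smul_apply, PiLp.add_apply, smul_eq_mul, e0]
      field_simp
    · simp only [pt2_1, PiLp.smul_apply, PiLp.add_apply, smul_eq_mul, e1]
      simp
  · intro α β hα hβ h
    by_contra! hc
    apply h1
    set m := α * (s 1 * a 1) + β * (s 1 * b 1) with hm
    have := hsm _ m⁻¹ (by positivity) (key α β hα hβ)
    convert this using 1
    have e1 : α * a 0 + β * b 0 = 0 := by linear_combination s 0 * h - (α * a 0 + β * b 0) * hs 0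
    have e0 : α * a 1 + β * b 1 = s 1 * m := by
      rw [hm]; linear_combination -(α * a 1 + β * b 1) * hs 1
    apply vec_ext
    · simp only [pt2_0, PiLp.smul_apply, PiLp.add_apply, smul_eq_mul, e1]
      simp
    · simp only [pt2_1, PiLp.smul_apply, PiLp.add_apply, smul_eq_mul, e0]
      field_simp

lemma quad {C : EucR 2 → Prop} (hadd : ∀ d e, C d → C e → C (d + e))
    (hsm : ∀ d (a : ℝ), 0 ≤ a → C d → C (a • d)) {s : Fin 2 → ℝ} (hs : ∀ i, s i * s i = 1)
    (h0 : ¬ C (pt2 (s 0) 0)) (h1 : ¬ C (pt2 0 (s 1))) {y v d : EucR 2} (hy : C y) (hv : C v)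
    (hd : C d) (hy0 : 0 < s 0 * y 0) (hy1 : 0 < s 1 * y 1) (hyv : y 0 * v 1 - y 1 * v 0 ≠ 0)
    (hd0 : d ≠ 0) : 0 < s 0 * d 0 ∧ 0 < s 1 * d 1 := by
  have A := quad_aux hadd hsm hs h0 h1 hy hd
  have B := quad_aux hadd hsm hs h0 h1 hd hv
  have D := quad_aux hadd hsm hs h0 h1 hy hv
  have hs0 : s 0 ≠ 0 := fun h => by have := hs 0; simp [h] at this
  have hs1 : s 1 ≠ 0 := fun h => by have := hs 1; simp [h] at this
  have hyv' : (s 0 * y 0) * (s 1 * v 1) - (s 1 * y 1) * (s 0 * v 0) ≠ 0 := by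
    have : (s 0 * y 0) * (s 1 * v 1) - (s 1 * y 1) * (s 0 * v 0)
      = s 0 * s 1 * (y 0 * v 1 - y 1 * v 0) := by ring
    rw [this]
    exact mul_ne_zero (mul_ne_zero hs0 hs1) hyv
  have hd' : ¬ (s 0 * d 0 = 0 ∧ s 1 * d 1 = 0) := by
    rintro ⟨h, h'⟩
    apply hd0
    apply vec_ext
    · simpa [hs0] using h
    · simpa [hs1] using h'
  generalize s 0 * y 0 = y0 at *
  generalize s 1 * y 1 = y1 at *
  generalize s 0 * v 0 = v0 at *
  generalize s 1 * v 1 = v1 at *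
  generalize s 0 * d 0 = d0 at *
  generalize s 1 * d 1 = d1 at *
  clear hadd hsm hs h0 h1 hyv hs0 hs1
  by_contra hcon
  rcases lt_trichotomy (y0 * d1 - y1 * d0) 0 with h | h | h
  · have hd1 : d1 ≤ 0 := by
      by_contra! h1
      have : 0 < y1 * d0 := by nlinarith [mul_pos hy0 h1]
      exact hcon ⟨by nlinarith [pos_of_mul_pos_right this hy1.le, (pos_iff_pos_of_mul_pos this).mp hy1], h1⟩
    have := A.1 (-d1) y1 (by linarith) hy1.le (by ring)
    nlinarith
  · -- d is a nonpositive multiple of y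
    have hneg0 : d0 < 0 := by
      by_contra! hh
      rcases hh.eq_or_lt with e | e
      · subst e
        apply hd'
        refine ⟨rfl, ?_⟩
        have : y0 * d1 = 0 := by linarith
        rcases mul_eq_zero.mp this with h | h
        · exact absurd h hy0.ne'
        · exact h
      · have : 0 < y0 * d1 := by nlinarith [mul_pos hy1 e]
        exact hcon ⟨e, (pos_iff_pos_of_mul_pos this).mp hy0⟩
    have hneg1 : d1 < 0 := by
      by_contra! hh
      nlinarith [mul_nonneg hy0.le hh, mul_pos hy1 (neg_pos.mpr hneg0)]
    rcases lt_or_gt_of_ne hyv' with g | g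
    · rcases le_total v1 0 with hv1 | hv1
      · have := D.1 (-v1) y1 (by linarith) hy1.le (by ring)
        nlinarith
      · have := B.1 v1 (-d1) hv1 (by linarith) (by ring)
        -- v1 * d0 - d1 * v0 ≤ 0
        have h3 : y0 * (v1 * d0 + -d1 * v0) = d0 * (y0 * v1 - y1 * v0) := by
          linear_combination (-v0) * h
        nlinarith [mul_pos_of_neg_of_neg hneg0 g]
    · rcases le_total v0 0 with hv1 | hv1
      · have := D.2 (-v0) y0 (by linarith) hy0.le (by ring)
        nlinarith
      · have := B.2 v0 (-d0) hv1 (by linarith) (by ring)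
        have h3 : y0 * (v0 * d1 + -d0 * v1) = -d0 * (y0 * v1 - y1 * v0) := by
          linear_combination (v0) * h
        nlinarith [mul_pos (neg_pos.mpr hneg0) g]
  · have hd1 : d0 ≤ 0 := by
      by_contra! h1
      have : 0 < y0 * d1 := by nlinarith [mul_pos hy1 h1]
      exact hcon ⟨h1, (pos_iff_pos_of_mul_pos this).mp hy0⟩
    have := A.2 (-d0) y0 (by linarith) hy0.le (by ring)
    nlinarith

/-- Signed parametrisation of the quarter circle. -/
noncomputable def U (s : Fin 2 → ℝ) (θ : ℝ) : EucR 2 := pt2 (s 0 * Real.cos θ) (s 1 * Real.sin θ)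

lemma U_lip {s : Fin 2 → ℝ} (hs : ∀ i, s i * s i = 1) : LipschitzWith 1 (U s) := by
  apply LipschitzWith.of_dist_le_mul
  intro a b
  rw [EuclideanSpace.dist_eq, NNReal.coe_one, one_mul, Real.dist_eq, ← Real.sqrt_sq_eq_abs]
  apply Real.sqrt_le_sqrt
  simp only [Fin.sum_univ_two, U, pt2_0, pt2_1, Real.dist_eq, sq_abs]
  have e : (s 0 * Real.cos a - s 0 * Real.cos b) ^ 2 + (s 1 * Real.sin a - s 1 * Real.sin b) ^ 2
      = 2 - 2 * Real.cos (a - b) := by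
    rw [Real.cos_sub]
    linear_combination (Real.cos a - Real.cos b)^2 * hs 0 + (Real.sin a - Real.sin b)^2 * hs 1
      + Real.sin_sq_add_cos_sq a + Real.sin_sq_add_cos_sq b
  rw [e]
  have := Real.one_sub_sq_div_two_le_cos (x := a - b)
  linarith

lemma arc_le {s : Fin 2 → ℝ} (hs : ∀ i, s i * s i = 1) (a b : ℝ) :
    μH[1] (U s '' Ioo a b) ≤ ENNReal.ofReal (b - a) := by
  have := (U_lip hs).hausdorffMeasure_image_le (d := 1) zero_le_one (Ioo a b)
  simpa [hausdorffMeasure_real] using this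

lemma exists_angle {s : Fin 2 → ℝ} (hs : ∀ i, s i * s i = 1) {d : EucR 2}
    (h0 : 0 < s 0 * d 0) (h1 : 0 < s 1 * d 1) :
    ∃ θ ∈ Ioo 0 (Real.pi / 2), ‖d‖⁻¹ • d = U s θ := by
  have hd : d ≠ 0 := by rintro rfl; simp at h0
  have hn : 0 < ‖d‖ := norm_pos_iff.mpr hd
  have hsq : ‖d‖ ^ 2 = d 0 ^ 2 + d 1 ^ 2 := by
    rw [EuclideanSpace.norm_sq_eq]; simp [Fin.sum_univ_two]
  set c := s 0 * d 0 / ‖d‖ with hc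
  have hc0 : 0 < c := by positivity
  set e := s 1 * d 1 / ‖d‖ with he
  have he0 : 0 < e := by positivity
  have hce : c ^ 2 + e ^ 2 = 1 := by
    rw [hc, he, div_pow, div_pow, ← add_div, div_eq_one_iff_eq (by positivity), hsq]
    linear_combination d 0 ^ 2 * hs 0 + d 1 ^ 2 * hs 1
  have hc1 : c < 1 := by nlinarith
  refine ⟨Real.arccos c, ⟨Real.arccos_pos.mpr hc1, Real.arccos_lt_pi_div_two.mpr hc0⟩, ?_⟩
  have hcos : Real.cos (Real.arccos c) = c := Real.cos_arccos (by linarith) hc1.le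
  have hsin : Real.sin (Real.arccos c) = e := by
    rw [Real.sin_arccos, show 1 - c ^ 2 = e ^ 2 by linarith, Real.sqrt_sq he0.le]
  apply vec_ext
  · rw [U, pt2_0, hcos, hc, PiLp.smul_apply, smul_eq_mul, div_eq_inv_mul]
    linear_combination -‖d‖⁻¹ * d 0 * hs 0
  · rw [U, pt2_1, hsin, he, PiLp.smul_apply, smul_eq_mul, div_eq_inv_mul]
    linear_combination -‖d‖⁻¹ * d 1 * hs 1

/-- Key: in an obtuse body one can start along one of the two axis directions. -/
lemma axis_dir {K : Set (EucR 2)} (hK : IsConvexBody K) (hob : Obtuse K) {s : Fin 2 → ℝ}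
    (hs : ∀ i, s i * s i = 1) {z y : EucR 2} (hz : z ∈ K) (hy : y ∈ K)
    (hy0 : ∀ i, 0 < s i * (y i - z i)) :
    Cn z K (pt2 (s 0) 0) ∨ Cn z K (pt2 0 (s 1)) := by
  by_contra! hcon
  obtain ⟨n0, n1⟩ := hcon
  obtain ⟨hc, hcomp, p, hp⟩ := hK
  have hadd : ∀ d e, Cn z K d → Cn z K e → Cn z K (d + e) := fun d e h h' => h.add hc h'
  have hsm : ∀ d (a : ℝ), 0 ≤ a → Cn z K d → Cn z K (a • d) := fun d a ha h => h.smul hz ha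
  have hyC : Cn z K (y - z) := Cn.of_mem hy
  have hs0 : s 0 ≠ 0 := fun h => by have := hs 0; simp [h] at this
  have hs1 : s 1 ≠ 0 := fun h => by have := hs 1; simp [h] at this
  have hyz : 0 < (y - z) 0 ^ 2 + (y - z) 1 ^ 2 := by
    have h : (y - z) 0 ≠ 0 := by
      intro h
      have := hy0 0
      simp only [PiLp.sub_apply] at h
      simp [h] at this
    positivity
  -- a transversal point
  obtain ⟨v, hv, hyv⟩ : ∃ v, Cn z K v ∧ (y - z) 0 * v 1 - (y - z) 1 * v 0 ≠ 0 := by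
    by_contra! H
    obtain ⟨ε, hε, hpe⟩ := int_dir hp (pt2 (-(y - z) 1) ((y - z) 0))
    have e1 := H _ (Cn.of_mem (interior_subset hp))
    have e2 := H _ (Cn.of_mem hpe)
    simp only [PiLp.sub_apply, PiLp.add_apply, PiLp.smul_apply, pt2_0, pt2_1, smul_eq_mul] at e1 e2 hyz
    have : ε * ((y 0 - z 0) ^ 2 + (y 1 - z 1) ^ 2) = 0 := by linear_combination e2 - e1
    have h := mul_pos hε hyz
    linarith
  have hQ : ∀ d, Cn z K d → d ≠ 0 → 0 < s 0 * d 0 ∧ 0 < s 1 * d 1 := fun d hd hd0 =>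
    quad hadd hsm hs n0 n1 hyC hv hd (hy0 0) (hy0 1) hyv hd0
  -- z is on the boundary
  have hzi : z ∉ interior K := by
    intro h
    obtain ⟨ε, hε, he⟩ := int_dir h (pt2 (-s 0) 0)
    have := hQ _ ⟨ε, hε, he⟩ (by
      intro h
      have := congrArg (fun v : EucR 2 => v 0) h
      simp [pt2_0, hs0] at this)
    simp [pt2_1] at this
  have hzf : z ∈ frontier K := by
    rw [hcomp.isClosed.frontier_eq]
    exact ⟨hz, hzi⟩
  have hdir : ∀ u ∈ dirSet z K, ∃ θ ∈ Ioo 0 (Real.pi / 2), u = U s θ ∧ Cn z K u := by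
    rintro u ⟨w, hw, hwz, rfl⟩
    have hC := Cn.of_mem (z := z) hw
    have := hQ _ hC (sub_ne_zero.mpr hwz)
    obtain ⟨θ, hθ, e⟩ := exists_angle hs this.1 this.2
    exact ⟨θ, hθ, e, hsm _ _ (by positivity) hC⟩
  have hge : ENNReal.ofReal (Real.pi / 2) ≤ angMeasure z K := by
    rcases hob z hzf with h | h
    · exact h.le
    · exact h.1.ge
  have hpi := Real.pi_pos
  -- every direction of the open quadrant is attained
  have hall : ∀ θ ∈ Ioo 0 (Real.pi / 2), Cn z K (U s θ) := by
    by_contra! H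
    obtain ⟨θ, hθ, hn⟩ := H
    have comb : ∀ a ∈ Ioo 0 θ, ∀ b ∈ Ioo θ (Real.pi / 2), Cn z K (U s a) → ¬ Cn z K (U s b) := by
      intro a ha b hb hCa hCb
      apply hn
      have h1 : 0 < Real.sin (b - θ) := Real.sin_pos_of_pos_of_lt_pi (by linarith [hb.1])
        (by linarith [hb.2, hθ.1])
      have h2 : 0 < Real.sin (θ - a) := Real.sin_pos_of_pos_of_lt_pi (by linarith [ha.2])
        (by linarith [ha.1, hθ.2])
      have h3 : 0 < Real.sin (b - a) := Real.sin_pos_of_pos_of_lt_pi (by linarith [ha.2, hb.1])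
        (by linarith [ha.1, hb.2])
      have := hsm _ (Real.sin (b - a))⁻¹ (by positivity)
        (hadd _ _ (hsm _ _ h1.le hCa) (hsm _ _ h2.le hCb))
      convert this using 1
      rw [eq_inv_smul_iff₀ h3.ne']
      apply vec_ext
      · simp only [U, PiLp.add_apply, PiLp.smul_apply, pt2_0, smul_eq_mul, Real.sin_sub]
        ring
      · simp only [U, PiLp.add_apply, PiLp.smul_apply, pt2_1, smul_eq_mul, Real.sin_sub]
        ring
    have hsub : dirSet z K ⊆ U s '' Ioo 0 θ ∨ dirSet z K ⊆ U s '' Ioo θ (Real.pi / 2) := by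
      by_cases hex : ∃ a ∈ Ioo 0 θ, Cn z K (U s a)
      · obtain ⟨a, ha, hCa⟩ := hex
        left
        intro u hu
        obtain ⟨φ, hφ, rfl, hCu⟩ := hdir u hu
        refine ⟨φ, ⟨hφ.1, ?_⟩, rfl⟩
        by_contra! hle
        rcases hle.eq_or_lt with e | e
        · exact hn (e ▸ hCu)
        · exact comb a ha φ ⟨e, hφ.2⟩ hCa hCu
      · push Not at hex
        right
        intro u hu
        obtain ⟨φ, hφ, rfl, hCu⟩ := hdir u hu
        refine ⟨φ, ⟨?_, hφ.2⟩, rfl⟩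
        by_contra! hle
        rcases hle.eq_or_lt with e | e
        · exact hn (e ▸ hCu)
        · exact hex φ ⟨hφ.1, e⟩ hCu
    rcases hsub with h | h
    · have h2 := hge.trans ((measure_mono h).trans (arc_le hs _ _))
      rw [ENNReal.ofReal_le_ofReal_iff (by linarith [hθ.1])] at h2
      linarith [hθ.2]
    · have h2 := hge.trans ((measure_mono h).trans (arc_le hs _ _))
      rw [ENNReal.ofReal_le_ofReal_iff (by linarith [hθ.2])] at h2
      linarith [hθ.1]
  rcases hob z hzf with h | ⟨_, h⟩
  · have hle : angMeasure z K ≤ ENNReal.ofReal (Real.pi / 2 - 0) :=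
      (measure_mono (fun u hu => by
        obtain ⟨θ, hθ, rfl, _⟩ := hdir u hu
        exact ⟨θ, hθ, rfl⟩)).trans (arc_le hs 0 (Real.pi / 2))
    rw [sub_zero] at hle
    exact absurd h (not_lt.mpr hle)
  · apply h
    have hT : TCone z K \ {z} = {w : EucR 2 | 0 < s 0 * (w 0 - z 0)} ∩ {w : EucR 2 | 0 < s 1 * (w 1 - z 1)} := by
      ext w
      simp only [TCone, rayFrom, mem_sdiff, mem_iUnion, mem_ofPred_eq, mem_singleton_iff, mem_inter_iff]
      constructor
      · rintro ⟨⟨q, ⟨hq, hqz⟩, t, ht, rfl⟩, hne⟩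
        have ht' : 0 < t := by
          rcases ht.eq_or_lt with e | e
          · subst e; simp at hne
          · exact e
        have := hQ _ (Cn.of_mem hq) (sub_ne_zero.mpr hqz)
        simp only [PiLp.sub_apply, PiLp.add_apply, PiLp.smul_apply, smul_eq_mul] at this ⊢
        constructor
        · have h := mul_pos ht' this.1
          linarith
        · have h := mul_pos ht' this.2
          linarith
      · rintro ⟨h0, h1⟩
        have hwz : w ≠ z := by rintro rfl; simp at h0
        refine ⟨?_, hwz⟩
        obtain ⟨θ, hθ, e⟩ := exists_angle hs (d := w - z) h0 h1
        obtain ⟨t, ht, hK⟩ := hall θ hθ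
        rw [← e] at hK
        have hn : 0 < ‖w - z‖ := norm_pos_iff.mpr (sub_ne_zero.mpr hwz)
        refine ⟨_, ⟨hK, ?_⟩, ‖w - z‖ / t, by positivity, ?_⟩
        · intro h
          have : t • ‖w - z‖⁻¹ • (w - z) = 0 := by simpa using h
          simp [ht.ne', hn.ne', sub_ne_zero.mpr hwz] at this
        · rw [add_sub_cancel_left, smul_smul, smul_smul]
          rw [show ‖w - z‖ / t * t * ‖w - z‖⁻¹ = 1 by field_simp]
          simp
    rw [hT]
    apply IsOpen.inter
    · exact isOpen_lt (by fun_prop) (by fun_prop)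
    · exact isOpen_lt (by fun_prop) (by fun_prop)

lemma local_reach {K : Set (EucR 2)} (hK : IsConvexBody K) (hob : Obtuse K) {s : Fin 2 → ℝ}
    (hs : ∀ i, s i * s i = 1) {z y : EucR 2} (hz : z ∈ K) (hy : y ∈ K)
    (hy0 : ∀ i, 0 < s i * (y i - z i)) :
    ∃ δ : ℝ, 0 < δ ∧ ∀ r, 0 ≤ r → r ≤ δ → r ≤ 1 →
      Relation.ReflTransGen (Step s K) z (z + r • (y - z)) := by
  have hc := hK.1
  have hyr : ∀ r : ℝ, 0 ≤ r → r ≤ 1 → z + r • (y - z) ∈ K := fun r h h' =>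
    hc.add_smul_sub_mem hz hy ⟨h, h'⟩
  have hcn : ∀ (d : EucR 2) (t : ℝ), 0 < t → z + t • d ∈ K → ∀ r : ℝ, 0 ≤ r → r ≤ t → z + r • d ∈ K := by
    intro d t ht h r hr hrt
    have := hc.add_smul_sub_mem hz h (t := r / t) ⟨by positivity, by rwa [div_le_one ht]⟩
    rwa [add_sub_cancel_left, smul_smul, div_mul_cancel₀ _ ht.ne'] at this
  rcases axis_dir hK hob hs hz hy hy0 with ⟨t, ht, h⟩ | ⟨t, ht, h⟩
  · refine ⟨t / (s 0 * (y 0 - z 0)), div_pos ht (hy0 0), fun r hr hrd hr1 => ?_⟩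
    rw [le_div_iff₀ (hy0 0)] at hrd
    have hm := hcn _ t ht h (r * (s 0 * (y 0 - z 0))) (mul_nonneg hr (hy0 0).le) hrd
    refine .head (b := z + (r * (s 0 * (y 0 - z 0))) • pt2 (s 0) 0) ⟨⟨0, ?_⟩, hc.segment_subset hz hm, ?_⟩
      (.single ⟨⟨1, ?_⟩, hc.segment_subset hm (hyr r hr hr1), ?_⟩)
    · intro j hj
      fin_cases j
      · simp at hj
      · simp [pt2_1]
    · rw [Fin.forall_fin_two]
      have := mul_nonneg hr (hy0 0).le
      constructor
      · simp [pt2_0]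
        linear_combination this - (r * (s 0 * (y 0 - z 0))) * hs 0
      · simp [pt2_1]
    · intro j hj
      fin_cases j
      · simp [pt2_0]
        linear_combination r * (y 0 - z 0) * hs 0
      · simp at hj
    · rw [Fin.forall_fin_two]
      have := mul_nonneg hr (hy0 1).le
      constructor
      · simp [pt2_0]
        apply le_of_eq
        linear_combination s 0 * r * (y 0 - z 0) * hs 0
      · simp [pt2_1]
        linarith
  · refine ⟨t / (s 1 * (y 1 - z 1)), div_pos ht (hy0 1), fun r hr hrd hr1 => ?_⟩
    rw [le_div_iff₀ (hy0 1)] at hrd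
    have hm := hcn _ t ht h (r * (s 1 * (y 1 - z 1))) (mul_nonneg hr (hy0 1).le) hrd
    refine .head (b := z + (r * (s 1 * (y 1 - z 1))) • pt2 0 (s 1)) ⟨⟨1, ?_⟩, hc.segment_subset hz hm, ?_⟩
      (.single ⟨⟨0, ?_⟩, hc.segment_subset hm (hyr r hr hr1), ?_⟩)
    · intro j hj
      fin_cases j
      · simp [pt2_0]
      · simp at hj
    · rw [Fin.forall_fin_two]
      have := mul_nonneg hr (hy0 1).le
      constructor
      · simp [pt2_0]
      · simp [pt2_1]
        linear_combination this - (r * (s 1 * (y 1 - z 1))) * hs 1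
    · intro j hj
      fin_cases j
      · simp at hj
      · simp [pt2_1]
        linear_combination r * (y 1 - z 1) * hs 1
    · rw [Fin.forall_fin_two]
      have := mul_nonneg hr (hy0 0).le
      constructor
      · simp [pt2_0]
        linarith
      · simp [pt2_1]
        apply le_of_eq
        linear_combination s 1 * r * (y 1 - z 1) * hs 1

lemma reach {K : Set (EucR 2)} (hK : IsConvexBody K) (hob : Obtuse K) {s : Fin 2 → ℝ}
    (hs : ∀ i, s i * s i = 1) {x y : EucR 2} (hx : x ∈ K) (hy : y ∈ K)
    (hxy : ∀ i, 0 < s i * (y i - x i)) : Relation.ReflTransGen (Step s K) x y := by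
  have hc := hK.1
  set γ : ℝ → EucR 2 := fun t => x + t • (y - x) with hγ
  have hγK : ∀ t, 0 ≤ t → t ≤ 1 → γ t ∈ K := fun t h h' => hc.add_smul_sub_mem hx hy ⟨h, h'⟩
  have fwd : ∀ t, 0 ≤ t → t < 1 → ∃ t', t < t' ∧ t' ≤ 1 ∧
      Relation.ReflTransGen (Step s K) (γ t) (γ t') := by
    intro t h0 h1
    obtain ⟨δ, hδ, H⟩ := local_reach hK hob hs (hγK t h0 h1.le) hy (fun i => by
      have := mul_pos (sub_pos.mpr h1) (hxy i)
      simp [hγ]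
      linarith)
    have hm : 0 < min δ 1 := lt_min hδ one_pos
    have h2 := H (min δ 1) hm.le (min_le_left _ _) (min_le_right _ _)
    refine ⟨t + min δ 1 * (1 - t), ?_, ?_, ?_⟩
    · have := mul_pos hm (sub_pos.mpr h1); linarith
    · nlinarith [min_le_right δ 1]
    · convert h2 using 1
      ext i
      simp [hγ]
      ring
  have bwd : ∀ t, 0 < t → t ≤ 1 → ∃ ε, 0 < ε ∧ ∀ t', t - ε ≤ t' → 0 ≤ t' → t' ≤ t →
      Relation.ReflTransGen (Step s K) (γ t') (γ t) := by
    intro t h0 h1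
    obtain ⟨δ, hδ, H⟩ := local_reach hK hob (s := fun i => - s i) (fun i => by simpa using hs i)
      (hγK t h0.le h1) hx (fun i => by
      have := mul_pos h0 (hxy i)
      simp [hγ]
      linarith)
    refine ⟨δ * t, by positivity, fun t' ha hb hc' => ?_⟩
    have h2 := reach_flip (H ((t - t') / t) (div_nonneg (by linarith) h0.le)
      (by rw [div_le_iff₀ h0]; linarith) (by rw [div_le_one h0]; linarith))
    convert h2 using 1
    ext i
    simp [hγ]
    field_simp
    ring
  set S : Set ℝ := {t | 0 ≤ t ∧ t ≤ 1 ∧ Relation.ReflTransGen (Step s K) x (γ t)} with hS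
  have hS0 : (0 : ℝ) ∈ S := ⟨le_rfl, zero_le_one, by simp [hγ]; exact .refl⟩
  have hbd : BddAbove S := ⟨1, fun t ht => ht.2.1⟩
  have hm0 : 0 ≤ sSup S := le_csSup hbd hS0
  have hm1 : sSup S ≤ 1 := csSup_le ⟨0, hS0⟩ fun t ht => ht.2.1
  have hmem : sSup S ∈ S := by
    rcases hm0.eq_or_lt with e | e
    · rw [← e]; exact hS0
    · obtain ⟨ε, hε, H⟩ := bwd _ e hm1
      obtain ⟨t, ht, hlt⟩ := exists_lt_of_lt_csSup ⟨0, hS0⟩ (show sSup S - ε < sSup S by linarith)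
      exact ⟨hm0, hm1, ht.2.2.trans (H t hlt.le ht.1 (le_csSup hbd ht))⟩
  have h1 : sSup S = 1 := by
    by_contra hne
    obtain ⟨t', ht, ht1, hr⟩ := fwd _ hm0 (lt_of_le_of_ne hm1 hne)
    have : t' ∈ S := ⟨by linarith, ht1, hmem.2.2.trans hr⟩
    have := le_csSup hbd this
    linarith
  have := hmem.2.2
  rw [h1] at this
  simpa [hγ] using this

lemma exists_sign (a : ℝ) : ∃ σ : ℝ, σ * σ = 1 ∧ 0 ≤ σ * a ∧ (a ≠ 0 → 0 < σ * a) := by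
  rcases le_total 0 a with h | h
  · exact ⟨1, by norm_num, by linarith, fun h' => by
      have := lt_of_le_of_ne h h'.symm
      linarith⟩
  · exact ⟨-1, by norm_num, by linarith, fun h' => by
      have := lt_of_le_of_ne h h'
      linarith⟩

end ObtuseStair

/-- Every obtuse planar convex body is staircase connected. -/
theorem obtuse_convexBody_staircaseConnected (K : Set (EucR 2))
    (hK : IsConvexBody K) (hob : Obtuse K) :
    StaircaseConnected K := by
  intro x hx y hy
  choose s hs hs1 hs2 using fun i : Fin 2 => ObtuseStair.exists_sign (y i - x i)
  apply ObtuseStair.stair_of_reach hs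
  by_cases h0 : y 0 - x 0 = 0
  · refine .single ⟨⟨1, fun j hj => ?_⟩, hK.1.segment_subset hx hy, hs1⟩
    fin_cases j
    · simpa using (sub_eq_zero.mp h0).symm
    · simp at hj
  by_cases h1 : y 1 - x 1 = 0
  · refine .single ⟨⟨0, fun j hj => ?_⟩, hK.1.segment_subset hx hy, hs1⟩
    fin_cases j
    · simp at hj
    · simpa using (sub_eq_zero.mp h1).symm
  refine ObtuseStair.reach hK hob hs hx hy ?_
  rw [Fin.forall_fin_two]
  exact ⟨hs2 0 h0, hs2 1 h1⟩
end

section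
/- Let K ⊆ ℝ² be a convex body and let a, b be non-obtuse vertices of K (i.e., α_a(K) ≤ π/2 and α_b(K) ≤ π/2). If the line through a and b is parallel to one of the coordinate axes, then K is staircase connected. -/
open Set MeasureTheory Bornology
open scoped ENNReal

/-- Unit circle arc in the orthonormal frame `e, f`. -/
noncomputable def arcPt (e f : EucR 2) (t : ℝ) : EucR 2 := Real.cos t • e + Real.sin t • f

lemma arcPt_norm (e f : EucR 2) (he : inner ℝ e e = (1:ℝ)) (hf : inner ℝ f f = (1:ℝ))
    (hef : inner ℝ e f = (0:ℝ)) (t : ℝ) : ‖arcPt e f t‖ = 1 := by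
  have hfe : inner ℝ f e = (0:ℝ) := by rw [real_inner_comm]; exact hef
  have h : ‖arcPt e f t‖ ^ 2 = 1 := by
    rw [← real_inner_self_eq_norm_sq]
    simp only [arcPt, inner_add_left, inner_add_right, real_inner_smul_left,
      real_inner_smul_right, he, hf, hef, hfe]
    nlinarith [Real.sin_sq_add_cos_sq t]
  nlinarith [norm_nonneg (arcPt e f t)]

lemma arcPt_continuous (e f : EucR 2) : Continuous (arcPt e f) := by
  unfold arcPt; fun_prop

lemma arcPt_injOn (e f : EucR 2) (he : inner ℝ e e = (1:ℝ))
    (hef : inner ℝ e f = (0:ℝ)) : InjOn (arcPt e f) (Icc 0 Real.pi) := by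
  intro s hs t ht h
  apply Real.injOn_cos hs ht
  have := congrArg (fun x => inner ℝ e x) h
  simpa only [arcPt, inner_add_right, real_inner_smul_right, he, hef, mul_one, mul_zero,
    add_zero] using this

lemma arc_base (e f : EucR 2) (he : inner ℝ e e = (1:ℝ)) (hf : inner ℝ f f = (1:ℝ))
    (hef : inner ℝ e f = (0:ℝ)) (s t : ℝ) (hs : s ≤ t) :
    ENNReal.ofReal (2 * Real.sin ((t - s) / 2)) ≤ μH[1] (arcPt e f '' Ico s t) := by
  have hfe : inner ℝ f e = (0:ℝ) := by rw [real_inner_comm]; exact hef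
  set m := (s + t) / 2 with hm
  set v := arcPt e f (m + Real.pi / 2) with hv
  have hvn : ‖v‖ = 1 := arcPt_norm e f he hf hef _
  have hval : ∀ u, inner ℝ v (arcPt e f u) = Real.sin (u - m) := by
    intro u
    simp only [hv, arcPt, inner_add_left, inner_add_right, real_inner_smul_left,
      real_inner_smul_right, he, hf, hef, hfe, Real.sin_sub, Real.cos_add_pi_div_two,
      Real.sin_add_pi_div_two]
    ring
  have hlip : LipschitzWith 1 (fun x : EucR 2 => (inner ℝ v x : ℝ)) := by
    have := (innerSL ℝ v).lipschitz
    have h2 : ‖innerSL ℝ v‖₊ = 1 := by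
      ext; simp [hvn]
    rw [h2] at this
    exact this
  have h1 := hlip.hausdorffMeasure_image_le (d := 1) zero_le_one (arcPt e f '' Ico s t)
  rw [image_image, hausdorffMeasure_real] at h1
  simp only [hval, ENNReal.coe_one, ENNReal.rpow_one, one_mul] at h1
  refine le_trans ?_ h1
  have h2 := intermediate_value_Ico (f := fun u => Real.sin (u - m)) hs (by fun_prop)
  refine le_trans ?_ (measure_mono h2)
  rw [Real.volume_Ico]
  apply ENNReal.ofReal_le_ofReal
  have e1 : t - m = (t - s) / 2 := by rw [hm]; ring
  have e2 : s - m = -((t - s) / 2) := by rw [hm]; ring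
  rw [e1, e2, Real.sin_neg]
  linarith

lemma arc_iter (e f : EucR 2) (he : inner ℝ e e = (1:ℝ)) (hf : inner ℝ f f = (1:ℝ))
    (hef : inner ℝ e f = (0:ℝ)) (n : ℕ) : ∀ (s t : ℝ), 0 ≤ s → s ≤ t → t ≤ Real.pi →
    ENNReal.ofReal (2 ^ n * (2 * Real.sin ((t - s) / 2 / 2 ^ n))) ≤
      μH[1] (arcPt e f '' Ico s t) := by
  induction n with
  | zero =>
    intro s t h0 hs ht
    simpa using arc_base e f he hf hef s t hs
  | succ n ih =>
    intro s t h0 hs ht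
    have i1 := ih s ((s + t) / 2) h0 (by linarith) (by linarith)
    have i2 := ih ((s + t) / 2) t (by linarith) (by linarith) ht
    have e1 : ((s + t) / 2 - s) / 2 / 2 ^ n = (t - s) / 2 / 2 ^ (n + 1) := by
      rw [pow_succ]; field_simp; ring
    have e2 : (t - (s + t) / 2) / 2 / 2 ^ n = (t - s) / 2 / 2 ^ (n + 1) := by
      rw [pow_succ]; field_simp; ring
    rw [e1] at i1
    rw [e2] at i2
    have hU : Ico s ((s + t) / 2) ∪ Ico ((s + t) / 2) t = Ico s t :=
      Ico_union_Ico_eq_Ico (by linarith) (by linarith)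
    have inj := arcPt_injOn e f he hef
    have hd : Disjoint (arcPt e f '' Ico s ((s + t) / 2)) (arcPt e f '' Ico ((s + t) / 2) t) := by
      rw [Set.disjoint_left]
      rintro _ ⟨u, hu, rfl⟩ ⟨w, hw, h⟩
      have := inj ⟨by linarith [hw.1], by linarith [hw.2]⟩
        ⟨by linarith [hu.1], by linarith [hu.2]⟩ h
      linarith [hw.1, hu.2]
    have hmeas : MeasurableSet (arcPt e f '' Ico ((s + t) / 2) t) :=
      measurableSet_Ico.image_of_continuousOn_injOn (arcPt_continuous e f).continuousOn
        (inj.mono fun u (hu : u ∈ Ico ((s + t) / 2) t) =>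
          (⟨by linarith [hu.1], by linarith [hu.2]⟩ : u ∈ Icc 0 Real.pi))
    rw [← hU, image_union, measure_union hd hmeas]
    refine le_trans ?_ (add_le_add i1 i2)
    refine le_trans (ENNReal.ofReal_le_ofReal (le_of_eq ?_)) ENNReal.ofReal_add_le
    rw [pow_succ]; ring

lemma arc_measure (e f : EucR 2) (he : inner ℝ e e = (1:ℝ)) (hf : inner ℝ f f = (1:ℝ))
    (hef : inner ℝ e f = (0:ℝ)) (φ : ℝ) (h0 : 0 < φ) (h1 : φ ≤ Real.pi) :
    ENNReal.ofReal φ ≤ μH[1] (arcPt e f '' Ico 0 φ) := by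
  have hlim : Filter.Tendsto (fun n : ℕ => (2:ℝ) ^ n * (2 * Real.sin ((φ - 0) / 2 / 2 ^ n)))
      Filter.atTop (nhds φ) := by
    have hd : HasDerivAt (fun x : ℝ => 2 * Real.sin (φ / 2 * x)) φ 0 := by
      have h := (((hasDerivAt_id (0:ℝ)).const_mul (φ / 2)).sin).const_mul 2
      have e : 2 * (Real.cos (φ / 2 * id 0) * (φ / 2 * 1)) = φ := by
        simp only [id, mul_zero, Real.cos_zero]; ring
      rw [e] at h
      exact h
    have h2 := hd.tendsto_slope_zero
    have h3 : Filter.Tendsto (fun n : ℕ => ((1:ℝ) / 2) ^ n) Filter.atTop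
        (nhdsWithin 0 {0}ᶜ) := by
      rw [tendsto_nhdsWithin_iff]
      refine ⟨tendsto_pow_atTop_nhds_zero_of_lt_one (by norm_num) (by norm_num), ?_⟩
      exact Filter.Eventually.of_forall fun n => by simp
    refine (h2.comp h3).congr fun n => ?_
    simp [div_eq_mul_inv]
  have h2 := (ENNReal.continuous_ofReal.tendsto φ).comp hlim
  exact le_of_tendsto h2 (Filter.Eventually.of_forall fun n =>
    arc_iter e f he hf hef n 0 φ le_rfl h0.le h1)

lemma mem_dirSet_of_comb (K : Set (EucR 2)) (hK : Convex ℝ K) (a b w u : EucR 2)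
    (ha : a ∈ K) (hb : b ∈ K) (hw : w ∈ K) (c d : ℝ) (hc : 0 ≤ c) (hd : 0 ≤ d)
    (hu : ‖u‖ = 1) (h : u = c • (b - a) + d • (w - a)) : u ∈ dirSet a K := by
  have hcd : 0 < c + d := by
    rcases lt_or_eq_of_le (add_nonneg hc hd) with h' | h'
    · exact h'
    · have hc0 : c = 0 := by linarith
      have hd0 : d = 0 := by linarith
      rw [h, hc0, hd0] at hu
      simp at hu
  have hy : (c / (c + d)) • b + (d / (c + d)) • w ∈ K :=
    hK hb hw (by positivity) (by positivity) (by field_simp)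
  have e1 : (c / (c + d)) • b + (d / (c + d)) • w - a = (c + d)⁻¹ • u := by
    rw [h]
    have : a = ((c + d)⁻¹ * (c + d)) • a := by rw [inv_mul_cancel₀ hcd.ne', one_smul]
    nth_rewrite 1 [this]
    simp only [div_eq_mul_inv]
    module
  have hn : ‖(c + d)⁻¹ • u‖ = (c + d)⁻¹ := by
    rw [norm_smul, hu, mul_one, Real.norm_of_nonneg (by positivity)]
  refine ⟨_, hy, ?_, ?_⟩
  · intro h'
    rw [← sub_eq_zero, e1] at h'
    rw [h', norm_zero] at hn
    have : 0 < (c + d)⁻¹ := by positivity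
    linarith
  · rw [e1, hn, smul_smul, inv_inv, mul_inv_cancel₀ hcd.ne', one_smul]

lemma angMeasure_gt_of_frame (K : Set (EucR 2)) (hK : Convex ℝ K) (a b w e f : EucR 2)
    (ha : a ∈ K) (hb : b ∈ K) (hw : w ∈ K)
    (he : inner ℝ e e = (1:ℝ)) (hf : inner ℝ f f = (1:ℝ)) (hef : inner ℝ e f = (0:ℝ))
    (l α β : ℝ) (hl : 0 < l) (hα : α < 0) (hβ : 0 < β)
    (hbe : b - a = l • e) (hwe : w - a = α • e + β • f) :
    ENNReal.ofReal (Real.pi / 2) < angMeasure a K := by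
  have hcont : Continuous fun t : ℝ => β * Real.cos t - α * Real.sin t := by fun_prop
  have hev : ∀ᶠ t in nhds (Real.pi / 2), 0 < β * Real.cos t - α * Real.sin t := by
    apply hcont.continuousAt.eventually_const_lt
    simp [hα]
  obtain ⟨δ, hδ, hball⟩ := Metric.eventually_nhds_iff.1 hev
  set φ := Real.pi / 2 + min δ (Real.pi / 2) with hφ
  have hpi := Real.pi_pos
  have hm0 : 0 < min δ (Real.pi / 2) := lt_min hδ (by linarith)
  have hm1 := min_le_left δ (Real.pi / 2)
  have hm2 := min_le_right δ (Real.pi / 2)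
  have hsub : arcPt e f '' Ico 0 φ ⊆ dirSet a K := by
    rintro _ ⟨t, ht, rfl⟩
    have hsin : 0 ≤ Real.sin t := Real.sin_nonneg_of_nonneg_of_le_pi ht.1 (by linarith [ht.2])
    have hpos : 0 ≤ β * Real.cos t - α * Real.sin t := by
      by_cases h : t ≤ Real.pi / 2
      · have := Real.cos_nonneg_of_mem_Icc (x := t) ⟨by linarith [ht.1], h⟩
        nlinarith [mul_nonneg hβ.le this, mul_nonneg (neg_nonneg.2 hα.le) hsin]
      · apply le_of_lt
        apply hball
        rw [Real.dist_eq, abs_of_pos (by linarith)]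
        linarith [ht.2]
    refine mem_dirSet_of_comb K hK a b w _ ha hb hw
      ((β * Real.cos t - α * Real.sin t) / (β * l)) (Real.sin t / β)
      (by positivity) (by positivity) (arcPt_norm e f he hf hef t) ?_
    rw [hbe, hwe, arcPt]
    have e1 : (β * Real.cos t - α * Real.sin t) / (β * l) * l + Real.sin t / β * α
        = Real.cos t := by field_simp; ring
    have e2 : Real.sin t / β * β = Real.sin t := by field_simp
    nth_rewrite 1 [← e1]
    nth_rewrite 3 [← e2]
    module
  calc ENNReal.ofReal (Real.pi / 2) < ENNReal.ofReal φ :=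
        (ENNReal.ofReal_lt_ofReal_iff (by linarith)).2 (by linarith)
    _ ≤ μH[1] (arcPt e f '' Ico 0 φ) := arc_measure e f he hf hef φ (by linarith) (by linarith)
    _ ≤ angMeasure a K := measure_mono hsub

lemma inner2 (x y : EucR 2) : inner ℝ x y = x 0 * y 0 + x 1 * y 1 := by
  simp [PiLp.inner_apply, Fin.sum_univ_two]; ring

/-- Noncollinear case. -/
lemma angMeasure_gt_noncol (K : Set (EucR 2)) (hK : Convex ℝ K) (a b w : EucR 2)
    (ha : a ∈ K) (hb : b ∈ K) (hw : w ∈ K)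
    (hneg : (b 0 - a 0) * (w 0 - a 0) + (b 1 - a 1) * (w 1 - a 1) < 0)
    (hne : (b 0 - a 0) * (w 1 - a 1) - (b 1 - a 1) * (w 0 - a 0) ≠ 0) :
    ENNReal.ofReal (Real.pi / 2) < angMeasure a K := by
  set p0 := b 0 - a 0 with hp0
  set p1 := b 1 - a 1 with hp1
  set q0 := w 0 - a 0 with hq0
  set q1 := w 1 - a 1 with hq1
  have hpp : 0 < p0 ^ 2 + p1 ^ 2 := by
    rcases eq_or_ne p0 0 with h | h
    · rcases eq_or_ne p1 0 with h' | h'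
      · rw [h, h'] at hne; simp at hne
      · positivity
    · positivity
  set l := Real.sqrt (p0 ^ 2 + p1 ^ 2) with hldef
  have hl : 0 < l := Real.sqrt_pos.2 hpp
  have hl2 : l ^ 2 = p0 ^ 2 + p1 ^ 2 := Real.sq_sqrt hpp.le
  obtain ⟨σ, hσ, hσpos⟩ : ∃ σ : ℝ, σ ^ 2 = 1 ∧ 0 < σ * (p0 * q1 - p1 * q0) := by
    rcases lt_or_gt_of_ne hne with h | h
    · exact ⟨-1, by norm_num, by linarith⟩
    · exact ⟨1, by norm_num, by linarith⟩
  refine angMeasure_gt_of_frame K hK a b w (!₂[p0 / l, p1 / l]) (!₂[-(σ * p1) / l, σ * p0 / l])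
    ha hb hw ?_ ?_ ?_ l ((p0 * q0 + p1 * q1) / l) (σ * (p0 * q1 - p1 * q0) / l) hl
    (div_neg_of_neg_of_pos hneg hl) (by positivity) ?_ ?_
  · rw [inner2]; simp; field_simp; linarith
  · rw [inner2]; simp; field_simp; rw [hσ, hl2]; ring
  · rw [inner2]; simp; field_simp; ring
  · ext i; fin_cases i <;> simp <;> field_simp <;> simp [hp0, hp1]
  · ext i; fin_cases i
    · simp; field_simp; rw [hl2, ← hq0]; linear_combination (p1 * (p0 * q1 - p1 * q0)) * hσ
    · simp; field_simp; rw [hl2, ← hq1]; linear_combination (-p0 * (p0 * q1 - p1 * q0)) * hσ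

lemma angMeasure_gt (K : Set (EucR 2)) (hK : IsConvexBody K) (a b y : EucR 2)
    (ha : a ∈ K) (hb : b ∈ K) (hy : y ∈ K)
    (hneg : (b 0 - a 0) * (y 0 - a 0) + (b 1 - a 1) * (y 1 - a 1) < 0) :
    ENNReal.ofReal (Real.pi / 2) < angMeasure a K := by
  by_cases hne : (b 0 - a 0) * (y 1 - a 1) - (b 1 - a 1) * (y 0 - a 0) = 0
  swap
  · exact angMeasure_gt_noncol K hK.1 a b y ha hb hy hneg hne
  obtain ⟨z, hz, hzne⟩ : ∃ z ∈ K,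
      (b 0 - a 0) * (z 1 - a 1) - (b 1 - a 1) * (z 0 - a 0) ≠ 0 := by
    by_contra! hall
    obtain ⟨z, hz⟩ := hK.2.2
    have hcont : Continuous fun t : ℝ => z + t • (!₂[-(b 1 - a 1), b 0 - a 0] : EucR 2) := by
      fun_prop
    have hev : ∀ᶠ t in nhds (0:ℝ),
        z + t • (!₂[-(b 1 - a 1), b 0 - a 0] : EucR 2) ∈ interior K := by
      apply hcont.continuousAt.eventually_mem
      apply isOpen_interior.mem_nhds
      simpa using hz
    obtain ⟨δ, hδ, hball⟩ := Metric.eventually_nhds_iff.1 hev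
    have h1 := hall _ (interior_subset (@hball (δ / 2) (by
      rw [Real.dist_eq, sub_zero, abs_of_pos (by positivity)]; linarith)))
    have h2 := hall z (interior_subset hz)
    simp at h1
    have h3 : δ / 2 * ((b 0 - a 0) ^ 2 + (b 1 - a 1) ^ 2) = 0 := by linear_combination h1 - h2
    have h4 : (b 0 - a 0) ^ 2 + (b 1 - a 1) ^ 2 = 0 := by
      rcases mul_eq_zero.1 h3 with h | h
      · linarith
      · exact h
    have h5 : b 0 - a 0 = 0 := by nlinarith [sq_nonneg (b 0 - a 0), sq_nonneg (b 1 - a 1)]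
    have h6 : b 1 - a 1 = 0 := by nlinarith [sq_nonneg (b 0 - a 0), sq_nonneg (b 1 - a 1)]
    rw [h5, h6] at hneg
    simp at hneg
  set N := (b 0 - a 0) * (y 0 - a 0) + (b 1 - a 1) * (y 1 - a 1) with hN
  set D := (b 0 - a 0) * (z 0 - y 0) + (b 1 - a 1) * (z 1 - y 1) with hD
  obtain ⟨s, hs0, hs1, hs⟩ : ∃ s : ℝ, 0 < s ∧ s ≤ 1 ∧ N + s * D < 0 := by
    have hcont : Continuous fun s : ℝ => N + s * D := by fun_prop
    have hev : ∀ᶠ s in nhds (0:ℝ), N + s * D < 0 := by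
      apply hcont.continuousAt.eventually_lt_const
      simpa using hneg
    obtain ⟨δ, hδ, hball⟩ := Metric.eventually_nhds_iff.1 hev
    refine ⟨min (δ / 2) 1, by positivity, min_le_right _ _, hball ?_⟩
    rw [Real.dist_eq, sub_zero, abs_of_pos (by positivity)]
    linarith [min_le_left (δ / 2) 1]
  have hwK : (1 - s) • y + s • z ∈ K :=
    hK.1 hy hz (by linarith) hs0.le (by ring)
  refine angMeasure_gt_noncol K hK.1 a b _ ha hb hwK ?_ ?_
  · simp
    rw [hN, hD] at hs
    linarith
  · simp
    intro h
    have : s * ((b 0 - a 0) * (z 1 - a 1) - (b 1 - a 1) * (z 0 - a 0)) = 0 := by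
      linear_combination h - (1 - s) * hne
    rcases mul_eq_zero.1 this with hh | hh
    · linarith
    · exact hzne hh

/-- Point with `i`-th coordinate `s` and all others `t`. -/
noncomputable def ptI (i : Fin 2) (s t : ℝ) : EucR 2 := WithLp.toLp 2 (fun k => if k = i then s else t)

lemma exists_median (x y c : ℝ) : ∃ m : ℝ, m ∈ uIcc c x ∧ m ∈ uIcc c y ∧
    0 ≤ (m - x) * (y - m) := by
  rcases le_total x c with h1 | h1 <;> rcases le_total y c with h2 | h2
  · refine ⟨max x y, ?_, ?_, ?_⟩
    · rw [uIcc_of_ge h1]; exact ⟨le_max_left _ _, max_le h1 h2⟩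
    · rw [uIcc_of_ge h2]; exact ⟨le_max_right _ _, max_le h1 h2⟩
    · rcases max_choice x y with h | h <;> rw [h] <;> simp
  · refine ⟨c, left_mem_uIcc, left_mem_uIcc, ?_⟩
    exact mul_nonneg (by linarith) (by linarith)
  · refine ⟨c, left_mem_uIcc, left_mem_uIcc, ?_⟩
    exact mul_nonneg_of_nonpos_of_nonpos (by linarith) (by linarith)
  · refine ⟨min x y, ?_, ?_, ?_⟩
    · rw [uIcc_of_le h1]; exact ⟨le_min h1 h2, min_le_left _ _⟩
    · rw [uIcc_of_le h2]; exact ⟨le_min h1 h2, min_le_right _ _⟩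
    · rcases min_choice x y with h | h <;> rw [h] <;> simp

lemma ptI_vert (K : Set (EucR 2)) (hK : Convex ℝ K) (i : Fin 2) (s c x m : ℝ)
    (hc : ptI i s c ∈ K) (hx : ptI i s x ∈ K) (hm : m ∈ uIcc c x) : ptI i s m ∈ K := by
  rw [← segment_eq_uIcc] at hm
  obtain ⟨u, v, hu, hv, huv, rfl⟩ := hm
  have : ptI i s (u • c + v • x) = u • ptI i s c + v • ptI i s x := by
    ext k
    simp only [ptI, PiLp.add_apply, PiLp.smul_apply, smul_eq_mul]
    split_ifs
    · rw [← add_mul, huv, one_mul]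
    · rfl
  rw [this]
  exact hK hc hx hu hv huv

lemma staircase_of_axis (K : Set (EucR 2)) (hK : Convex ℝ K) (i j : Fin 2) (hij : j ≠ i)
    (c : ℝ) (hc : ∀ x ∈ K, ptI i (x i) c ∈ K) : StaircaseConnected K := by
  have hcov : ∀ k : Fin 2, k = i ∨ k = j := by omega
  have heta : ∀ x : EucR 2, ptI i (x i) (x j) = x := by
    intro x
    ext k
    rcases hcov k with rfl | rfl
    · simp [ptI]
    · simp [ptI, hij]
  intro x hx y hy
  obtain ⟨m, hm1, hm2, hm3⟩ := exists_median (x j) (y j) c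
  have h1 : ptI i (x i) m ∈ K := ptI_vert K hK i (x i) c (x j) m (hc x hx) (by rwa [heta]) hm1
  have h2 : ptI i (y i) m ∈ K := ptI_vert K hK i (y i) c (y j) m (hc y hy) (by rwa [heta]) hm2
  set p : ℕ → EucR 2 := fun n => match n with
    | 0 => x
    | 1 => ptI i (x i) m
    | 2 => ptI i (y i) m
    | _ => y with hp
  have hxi : ∀ s t, (ptI i s t) i = s := fun s t => by simp [ptI]
  have hxj : ∀ s t, (ptI i s t) j = t := fun s t => by simp [ptI, hij]
  refine ⟨3, p, rfl, rfl, ?_, ?_⟩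
  · intro k hk
    interval_cases k
    · refine ⟨⟨j, fun k hk => ?_⟩, hK.segment_subset hx h1⟩
      rcases hcov k with rfl | rfl
      · exact (hxi _ _).symm
      · exact absurd rfl hk
    · refine ⟨⟨i, fun k hk => ?_⟩, hK.segment_subset h1 h2⟩
      rcases hcov k with rfl | rfl
      · exact absurd rfl hk
      · exact (hxj _ _).trans (hxj _ _).symm
    · refine ⟨⟨j, fun k hk => ?_⟩, hK.segment_subset h2 hy⟩
      rcases hcov k with rfl | rfl
      · exact hxi _ _
      · exact absurd rfl hk
  · intro k hk l hl r _ _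
    rcases hcov r with rfl | rfl <;> interval_cases k <;> interval_cases l <;>
      simp only [hp, hxi, hxj] <;> nlinarith [hm3, mul_self_nonneg (m - x r),
        mul_self_nonneg (y r - m), mul_self_nonneg (y r - x r)]

/-- If `a` and `b` are distinct non-obtuse vertices of the convex body `K ⊆ ℝ²` and
the line through `a` and `b` is parallel to a coordinate axis, then `K` is
staircase connected. -/
theorem staircaseConnected_of_nonObtuse_vertices (K : Set (EucR 2))
    (hK : IsConvexBody K) (a b : EucR 2)
    (ha : a ∈ frontier K) (hb : b ∈ frontier K) (hab : a ≠ b)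
    (hαa : angMeasure a K ≤ ENNReal.ofReal (Real.pi / 2))
    (hαb : angMeasure b K ≤ ENNReal.ofReal (Real.pi / 2))
    (haxis : a 0 = b 0 ∨ a 1 = b 1) :
    StaircaseConnected K := by
  have hcl : IsClosed K := hK.2.1.isClosed
  have haK : a ∈ K := hcl.frontier_subset ha
  have hbK : b ∈ K := hcl.frontier_subset hb
  have key1 : ∀ y ∈ K, 0 ≤ (b 0 - a 0) * (y 0 - a 0) + (b 1 - a 1) * (y 1 - a 1) := by
    intro y hy
    by_contra! h
    exact absurd hαa (not_le.2 (angMeasure_gt K hK a b y haK hbK hy h))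
  have key2 : ∀ y ∈ K, 0 ≤ (a 0 - b 0) * (y 0 - b 0) + (a 1 - b 1) * (y 1 - b 1) := by
    intro y hy
    by_contra! h
    exact absurd hαb (not_le.2 (angMeasure_gt K hK b a y hbK haK hy h))
  -- any point of `K` projects onto the segment `ab`
  have main : ∀ i j : Fin 2, j ≠ i → a j = b j → StaircaseConnected K := by
    intro i j hij hj
    have hcov : ∀ k : Fin 2, k = i ∨ k = j := by omega
    have hi : a i ≠ b i := by
      intro h
      apply hab
      ext k
      rcases hcov k with rfl | rfl
      · exact h
      · exact hj
    have k1 : ∀ y ∈ K, 0 ≤ (b i - a i) * (y i - a i) := by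
      intro y hy
      have := key1 y hy
      fin_cases i <;> fin_cases j <;> simp_all
    have k2 : ∀ y ∈ K, 0 ≤ (a i - b i) * (y i - b i) := by
      intro y hy
      have := key2 y hy
      fin_cases i <;> fin_cases j <;> simp_all
    refine staircase_of_axis K hK.1 i j hij (a j) fun y hy => ?_
    have d : b i - a i ≠ 0 := sub_ne_zero.2 hi.symm
    have d2 : 0 < (b i - a i) ^ 2 := by positivity
    have l1 := k1 y hy
    have l2 := k2 y hy
    have hmem : ((b i - a i) * (b i - y i) / (b i - a i) ^ 2) • a +
        ((b i - a i) * (y i - a i) / (b i - a i) ^ 2) • b ∈ K := by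
      refine hK.1 haK hbK (div_nonneg (by linarith) d2.le) (div_nonneg l1 d2.le) ?_
      field_simp; ring
    convert hmem using 1
    ext k
    rcases hcov k with rfl | rfl
    · simp [ptI]; field_simp; ring
    · simp [ptI, hij, ← hj]; field_simp; ring
  rcases haxis with h | h
  · exact main 1 0 (by decide) h
  · exact main 0 1 (by decide) h
end

section
/- The convex hull of a union of finitely many obtuse convex bodies in ℝ² is staircase connected. -/
open Set MeasureTheory Bornology
open scoped ENNReal

namespace StairAux

def R (C : Set (ℝ × ℝ)) (p q : ℝ × ℝ) : Prop :=
  p ∈ C ∧ q ∈ C ∧ p.1 ≤ q.1 ∧ p.2 ≤ q.2 ∧ (p.1 = q.1 ∨ p.2 = q.2)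

lemma comb {C : Set (ℝ × ℝ)} (hC : Convex ℝ C) {u v u' v' : ℝ} (h : (u, v) ∈ C)
    (h' : (u', v') ∈ C) (a : ℝ) (h0 : 0 ≤ a) (h1 : a ≤ 1) {p q : ℝ}
    (hp : p = a * u + (1 - a) * u') (hq : q = a * v + (1 - a) * v') : (p, q) ∈ C := by
  have := hC h h' h0 (sub_nonneg.2 h1) (by ring)
  simpa [hp, hq] using this

lemma caseA {C : Set (ℝ × ℝ)} (hC : Convex ℝ C) {a b c d t s : ℝ} (hab : a ≤ c) (hbd : b ≤ d)
    (h1 : (a, b) ∈ C) (h2 : (c, d) ∈ C) (ht : 0 < t) (hs : 0 < s)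
    (h3 : (a + t * (c - a), b) ∈ C) (h4 : (c, d - s * (d - b)) ∈ C) :
    Relation.ReflTransGen (R C) (a, b) (c, d) := by
  obtain ⟨N, hN⟩ := exists_nat_one_div_lt (lt_min ht hs)
  set l : ℝ := 1 / ((N : ℝ) + 1) with hl
  have hlt : l < t := hN.trans_le (min_le_left _ _)
  have hls : l < s := hN.trans_le (min_le_right _ _)
  have hN0 : (0 : ℝ) < (N : ℝ) + 1 := by positivity
  have hl0 : 0 < l := by positivity
  have hlN : l * ((N : ℝ) + 1) = 1 := by rw [hl]; field_simp
  have h3' : (a + l * (c - a), b) ∈ C := by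
    refine comb hC h3 h1 (l / t) (by positivity) ((div_le_one ht).2 hlt.le) ?_ ?_ <;>
      field_simp <;> ring
  have h4' : (c, d - l * (d - b)) ∈ C := by
    refine comb hC h4 h2 (l / s) (by positivity) ((div_le_one hs).2 hls.le) ?_ ?_ <;>
      field_simp <;> ring
  have hx : ∀ k : ℕ, k ≤ N + 1 → (a + k * l * (c - a), b + k * l * (d - b)) ∈ C := by
    intro k hk
    have hk' : (k : ℝ) ≤ N + 1 := by exact_mod_cast hk
    have hkl : k * l ≤ 1 := by nlinarith
    refine comb hC h2 h1 (k * l) (by positivity) hkl ?_ ?_ <;> ring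
  have hc : ∀ k : ℕ, k ≤ N → (a + (k + 1) * l * (c - a), b + k * l * (d - b)) ∈ C := by
    intro k hk
    have hk' : (k : ℝ) ≤ N := by exact_mod_cast hk
    rcases Nat.eq_zero_or_pos N with h0 | hpos
    · have hk0 : k = 0 := by omega
      subst hk0
      simpa using h3'
    have hNp : (0 : ℝ) < N := by exact_mod_cast hpos
    have hl' : l = 1 / ((N : ℝ) + 1) := hl
    refine comb hC h4' h3' (k / N) (by positivity) ((div_le_one hNp).2 hk') ?_ ?_
    · rw [hl']; field_simp; ring
    · rw [hl']; field_simp; ring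
  have main : ∀ k : ℕ, k ≤ N + 1 →
      Relation.ReflTransGen (R C) (a, b) (a + k * l * (c - a), b + k * l * (d - b)) := by
    intro k
    induction k with
    | zero => intro _; simpa using Relation.ReflTransGen.refl
    | succ k ih =>
      intro hk
      have e1 : 0 ≤ l * (c - a) := mul_nonneg hl0.le (sub_nonneg.2 hab)
      have e2 : 0 ≤ l * (d - b) := mul_nonneg hl0.le (sub_nonneg.2 hbd)
      have hx' := hx (k + 1) hk
      push_cast at hx' ⊢
      refine ((ih (by omega)).tail ⟨hx k (by omega), hc k (by omega), ?_, ?_, Or.inr ?_⟩).tail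
        ⟨hc k (by omega), hx', ?_, ?_, Or.inl ?_⟩ <;> simp only [] <;> nlinarith
  have := main (N + 1) le_rfl
  push_cast at this
  rw [mul_comm _ l, hlN] at this
  simpa using this

lemma convex_swap {C : Set (ℝ × ℝ)} (hC : Convex ℝ C) : Convex ℝ {p : ℝ × ℝ | p.swap ∈ C} := by
  intro p hp q hq a b ha hb hab
  exact hC hp hq ha hb hab

lemma swapR {C : Set (ℝ × ℝ)} {p q : ℝ × ℝ}
    (h : Relation.ReflTransGen (R {p : ℝ × ℝ | p.swap ∈ C}) p q) :
    Relation.ReflTransGen (R C) p.swap q.swap := by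
  refine Relation.ReflTransGen.lift Prod.swap ?_ _ _ h
  rintro a b ⟨h1, h2, h3, h4, h5⟩
  exact ⟨h1, h2, h4, h3, h5.symm⟩

lemma caseA' {C : Set (ℝ × ℝ)} (hC : Convex ℝ C) {a b c d t s : ℝ} (hab : a ≤ c) (hbd : b ≤ d)
    (h1 : (a, b) ∈ C) (h2 : (c, d) ∈ C) (ht : 0 < t) (hs : 0 < s)
    (h3 : (a, b + t * (d - b)) ∈ C) (h4 : (c - s * (c - a), d) ∈ C) :
    Relation.ReflTransGen (R C) (a, b) (c, d) :=
  swapR (caseA (C := {p : ℝ × ℝ | p.swap ∈ C}) (convex_swap hC) hbd hab h1 h2 ht hs h3 h4)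

lemma caseB {C : Set (ℝ × ℝ)} (hC : Convex ℝ C) (h1 : ((0 : ℝ), (0 : ℝ)) ∈ C)
    (h2 : ((1 : ℝ), (1 : ℝ)) ∈ C) {t s : ℝ} (ht : 0 < t) (hs : 0 < s)
    (h3 : (t, (0 : ℝ)) ∈ C) (h4 : (1 - s, (1 : ℝ)) ∈ C) :
    Relation.ReflTransGen (R C) (0, 0) (1, 1) := by
  obtain ⟨r, hr0, hrt, hrs, hr⟩ : ∃ r : ℝ, 0 < r ∧ r ≤ t ∧ r ≤ s ∧ r ≤ 1 / 4 := by
    refine ⟨min (min t s) (1 / 4), by positivity, ?_, ?_, min_le_right _ _⟩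
    · exact (min_le_left _ _).trans (min_le_left _ _)
    · exact (min_le_left _ _).trans (min_le_right _ _)
  have h3' : (r, (0 : ℝ)) ∈ C := by
    refine comb hC h3 h1 (r / t) (by positivity) ((div_le_one ht).2 hrt) ?_ ?_ <;>
      field_simp <;> ring
  have h4' : (1 - r, (1 : ℝ)) ∈ C := by
    refine comb hC h4 h2 (r / s) (by positivity) ((div_le_one hs).2 hrs) ?_ ?_ <;>
      field_simp <;> ring
  have hm : ((1 / 2 : ℝ), (1 / 2 : ℝ)) ∈ C := by
    refine comb hC h1 h2 (1 / 2) (by norm_num) (by norm_num) ?_ ?_ <;> norm_num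
  have h1r : 0 < 1 - r := by linarith
  set q : ℝ := (1 / 2 - r) / (1 - r) with hq
  have hqe : q * (1 - r) = 1 / 2 - r := by rw [hq]; field_simp
  have hq0 : 0 ≤ q := div_nonneg (by linarith) h1r.le
  have hq1 : q < 1 / 2 := by rw [hq, div_lt_iff₀ h1r]; linarith
  have hlow : ((1 / 2 : ℝ), q) ∈ C := by
    refine comb hC h2 h3' q hq0 (by linarith) ?_ ?_ <;> linarith
  have hup : ((1 / 2 : ℝ), 1 - q) ∈ C := by
    refine comb hC h1 h4' q hq0 (by linarith) ?_ ?_ <;> linarith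
  refine Relation.ReflTransGen.trans (b := ((1 / 2 : ℝ), (1 / 2 : ℝ))) ?_ ?_
  · refine caseA hC (t := 2 * r) (s := 1 - 2 * q) (by norm_num) (by norm_num) h1 hm (by linarith)
      (by linarith) ?_ ?_
    · convert h3' using 2; ring
    · convert hlow using 2; ring
  · refine caseA' hC (t := 1 - 2 * q) (s := 2 * r) (by norm_num) (by norm_num) hm h2 (by linarith)
      (by linarith) ?_ ?_
    · convert hup using 2; ring
    · convert h4' using 2; ring

/-- there is an axis direction towards `(1,1)` available at the origin -/
def Good (C : Set (ℝ × ℝ)) : Prop := ∃ t : ℝ, 0 < t ∧ ((t, (0 : ℝ)) ∈ C ∨ ((0 : ℝ), t) ∈ C)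

lemma good1 {C : Set (ℝ × ℝ)} (hC : Convex ℝ C) (h2 : ((1 : ℝ), (1 : ℝ)) ∈ C) {u v : ℝ}
    (h : (u, v) ∈ C) (hv : v ≤ 0) (huv : v < u) : Good C := by
  have hp : 0 < 1 - v := by linarith
  refine ⟨(u - v) / (1 - v), div_pos (by linarith) hp, Or.inl ?_⟩
  refine comb hC h h2 (1 / (1 - v)) (by positivity) ((div_le_one hp).2 (by linarith)) ?_ ?_ <;>
    field_simp <;> ring

lemma good1' {C : Set (ℝ × ℝ)} (hC : Convex ℝ C) (h2 : ((1 : ℝ), (1 : ℝ)) ∈ C) {u v : ℝ}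
    (h : (u, v) ∈ C) (hv : u ≤ 0) (huv : u < v) : Good C := by
  obtain ⟨t, ht, h⟩ := good1 (C := {p : ℝ × ℝ | p.swap ∈ C}) (convex_swap hC) h2 (u := v) (v := u)
    h hv huv
  exact ⟨t, ht, h.symm⟩

lemma good2 {C : Set (ℝ × ℝ)} (hC : Convex ℝ C) (h2 : ((1 : ℝ), (1 : ℝ)) ∈ C) {u p q : ℝ}
    (h : (u, u) ∈ C) (hu : u < 0) (hw : (p, q) ∈ C) (hpq : q < p) : Good C := by
  rcases le_or_gt q 0 with hq | hq
  · exact good1 hC h2 hw hq hpq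
  have hd : 0 < q - u := by linarith
  refine ⟨(-u) * (p - q) / (q - u), div_pos (mul_pos (by linarith) (by linarith)) hd, Or.inl ?_⟩
  refine comb hC hw h ((-u) / (q - u)) (div_nonneg (by linarith) hd.le)
    ((div_le_one hd).2 (by linarith)) ?_ ?_ <;> field_simp <;> ring

lemma good {C : Set (ℝ × ℝ)} (hC : Convex ℝ C) (h2 : ((1 : ℝ), (1 : ℝ)) ∈ C)
    (hz : ∃ u v : ℝ, (u, v) ∈ C ∧ ¬ (u = 0 ∧ v = 0) ∧ ¬ (0 < u ∧ 0 < v))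
    (hw : ∃ p q : ℝ, (p, q) ∈ C ∧ p ≠ q) : Good C := by
  obtain ⟨u, v, h, h0, hq⟩ := hz
  obtain ⟨p, q, hpq, hne⟩ := hw
  rcases lt_trichotomy u v with hlt | heq | hlt
  · refine good1' hC h2 h ?_ hlt
    by_contra hc; exact hq ⟨by linarith, by linarith⟩
  · subst heq
    have hu : u < 0 := by
      by_contra hc
      rcases (not_lt.1 hc).eq_or_lt with h' | h'
      · exact h0 ⟨h'.symm, h'.symm⟩
      · exact hq ⟨h', h'⟩
    rcases hne.lt_or_gt with hl | hl
    · obtain ⟨t, ht, h⟩ := good2 (C := {p : ℝ × ℝ | p.swap ∈ C}) (convex_swap hC) h2 (u := u)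
        (p := q) (q := p) h hu hpq hl
      exact ⟨t, ht, h.symm⟩
    · exact good2 hC h2 h hu hpq hl
  · refine good1 hC h2 h ?_ hlt
    by_contra hc; exact hq ⟨by linarith, by linarith⟩

lemma reach {C : Set (ℝ × ℝ)} (hC : Convex ℝ C) (h1 : ((0 : ℝ), (0 : ℝ)) ∈ C)
    (h2 : ((1 : ℝ), (1 : ℝ)) ∈ C) (ha : Good C)
    (hb : ∃ t : ℝ, 0 < t ∧ ((1 - t, (1 : ℝ)) ∈ C ∨ ((1 : ℝ), 1 - t) ∈ C)) :
    Relation.ReflTransGen (R C) (0, 0) (1, 1) := by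
  obtain ⟨t, ht, ha⟩ := ha
  obtain ⟨s, hs, hb⟩ := hb
  rcases ha with ha | ha <;> rcases hb with hb | hb
  · exact caseB hC h1 h2 ht hs ha hb
  · exact caseA hC zero_le_one zero_le_one h1 h2 ht hs (by simpa using ha) (by simpa using hb)
  · exact caseA' hC zero_le_one zero_le_one h1 h2 ht hs (by simpa using ha) (by simpa using hb)
  · exact swapR (caseB (C := {p : ℝ × ℝ | p.swap ∈ C}) (convex_swap hC) h1 h2 ht hs ha hb)

/-- the affine chart -/
def E (x d : EucR 2) (p : ℝ × ℝ) : EucR 2 := !₂[x 0 + p.1 * d 0, x 1 + p.2 * d 1]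

lemma E_zero (x d : EucR 2) (p) : E x d p 0 = x 0 + p.1 * d 0 := by simp [E]
lemma E_one (x d : EucR 2) (p) : E x d p 1 = x 1 + p.2 * d 1 := by simp [E]

lemma ext2 {x y : EucR 2} (h0 : x 0 = y 0) (h1 : x 1 = y 1) : x = y := by
  ext i; fin_cases i
  · exact h0
  · exact h1

lemma E_convex {K : Set (EucR 2)} (hK : Convex ℝ K) (x d : EucR 2) :
    Convex ℝ {p | E x d p ∈ K} := by
  intro p hp q hq a b ha hb hab
  have := hK hp hq ha hb hab
  have e : E x d (a • p + b • q) = a • E x d p + b • E x d q := by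
    have hb : b = 1 - a := by linarith
    subst hb
    apply ext2
    · simp [E_zero]; ring
    · simp [E_one]; ring
  rw [mem_ofPred_eq, e]; exact this

lemma E_surj (x d z : EucR 2) (h0 : d 0 ≠ 0) (h1 : d 1 ≠ 0) :
    E x d ((z 0 - x 0) / d 0, (z 1 - x 1) / d 1) = z := by
  apply ext2
  · rw [E_zero]; field_simp; ring
  · rw [E_one]; field_simp; ring

lemma path_of {α : Type*} {r : α → α → Prop} {x y : α} (h : Relation.ReflTransGen r x y) :
    ∃ n : ℕ, ∃ p : ℕ → α, p 0 = x ∧ p n = y ∧ ∀ k, k < n → r (p k) (p (k + 1)) := by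
  induction h using Relation.ReflTransGen.head_induction_on with
  | refl => exact ⟨0, fun _ => y, rfl, rfl, fun k hk => absurd hk (Nat.not_lt_zero k)⟩
  | @head a c hac _ ih =>
    obtain ⟨n, p, hp0, hpn, hp⟩ := ih
    refine ⟨n + 1, fun k => Nat.casesOn k a p, rfl, hpn, ?_⟩
    intro k hk
    cases k with
    | zero => simpa [hp0] using hac
    | succ k => exact hp k (by omega)

/-- not contained in an open quadrant, at every point -/
def NQ (K : Set (EucR 2)) : Prop := ∀ x ∈ K, ∀ d : EucR 2, d 0 ≠ 0 → d 1 ≠ 0 →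
  ∃ z ∈ K, z ≠ x ∧ ¬ (0 < d 0 * (z 0 - x 0) ∧ 0 < d 1 * (z 1 - x 1))

lemma good_of {K : Set (EucR 2)} (hK : Convex ℝ K) (hi : (interior K).Nonempty) (hQ : NQ K)
    (x d : EucR 2) (hx : x ∈ K) (hy : x + d ∈ K) (h0 : d 0 ≠ 0) (h1 : d 1 ≠ 0) :
    Good {p | E x d p ∈ K} := by
  apply good (E_convex hK x d)
  · have : E x d (1, 1) = x + d := by apply ext2 <;> simp [E_zero, E_one]
    rw [mem_ofPred_eq, this]; exact hy
  · obtain ⟨z, hz, hne, hq⟩ := hQ x hx d h0 h1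
    refine ⟨(z 0 - x 0) / d 0, (z 1 - x 1) / d 1, ?_, ?_, ?_⟩
    · rw [mem_ofPred_eq, E_surj x d z h0 h1]; exact hz
    · rintro ⟨ha, hb⟩
      rw [div_eq_zero_iff] at ha hb
      apply hne
      apply ext2
      · rcases ha with h | h
        · linarith
        · exact absurd h h0
      · rcases hb with h | h
        · linarith
        · exact absurd h h1
    · rintro ⟨ha, hb⟩
      apply hq
      have e0 : d 0 * (z 0 - x 0) = (z 0 - x 0) / d 0 * (d 0 * d 0) := by field_simp
      have e1 : d 1 * (z 1 - x 1) = (z 1 - x 1) / d 1 * (d 1 * d 1) := by field_simp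
      rw [e0, e1]
      exact ⟨mul_pos ha (mul_self_pos.2 h0), mul_pos hb (mul_self_pos.2 h1)⟩
  · obtain ⟨w, hw⟩ := hi
    by_contra hc
    push Not at hc
    have key : ∀ z ∈ K, (z 0 - x 0) / d 0 = (z 1 - x 1) / d 1 := by
      intro z hz
      apply hc
      rw [mem_ofPred_eq, E_surj x d z h0 h1]; exact hz
    have hcont : Continuous fun t : ℝ => w + t • (!₂[1, 0] : EucR 2) := by fun_prop
    have hev : ∀ᶠ t in nhds (0 : ℝ), w + t • (!₂[1, 0] : EucR 2) ∈ K := by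
      apply hcont.continuousAt.eventually
      simpa using mem_interior_iff_mem_nhds.1 hw
    obtain ⟨e, he, hball⟩ := Metric.eventually_nhds_iff.1 hev
    have hm : w + (e / 2) • (!₂[1, 0] : EucR 2) ∈ K := by
      apply hball
      rw [Real.dist_eq, sub_zero, abs_of_pos (by linarith)]; linarith
    have k1 := key _ hm
    have k2 := key _ (interior_subset hw)
    simp at k1
    rw [← k2] at k1
    field_simp at k1
    linarith

lemma stair {K : Set (EucR 2)} (hK : Convex ℝ K) (hi : (interior K).Nonempty) (hQ : NQ K) :
    StaircaseConnected K := by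
  intro x hx y hy
  by_cases hdeg : x 0 = y 0 ∨ x 1 = y 1
  · refine ⟨1, fun k => if k = 0 then x else y, by simp, by simp, ?_, ?_⟩
    · intro k hk
      obtain rfl : k = 0 := by omega
      refine ⟨?_, ?_⟩
      · rcases hdeg with h | h
        · refine ⟨1, fun j hj => ?_⟩
          fin_cases j
          · simpa using h
          · exact absurd rfl hj
        · refine ⟨0, fun j hj => ?_⟩
          fin_cases j
          · exact absurd rfl hj
          · simpa using h
      · simpa using hK.segment_subset hx hy
    · intro k hk l hl i _ _
      obtain rfl : k = 0 := by omega
      obtain rfl : l = 0 := by omega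
      exact mul_self_nonneg _
  push Not at hdeg
  set d : EucR 2 := y - x with hd
  have d0 : d 0 = y 0 - x 0 := by simp [hd]
  have d1 : d 1 = y 1 - x 1 := by simp [hd]
  have h0 : d 0 ≠ 0 := by rw [d0]; exact sub_ne_zero.2 hdeg.1.symm
  have h1 : d 1 ≠ 0 := by rw [d1]; exact sub_ne_zero.2 hdeg.2.symm
  have E0 : E x d (0, 0) = x := by apply ext2 <;> simp [E_zero, E_one]
  have E1 : E x d (1, 1) = y := by apply ext2 <;> simp [E_zero, E_one, d0, d1]
  have hr : Relation.ReflTransGen (R {p | E x d p ∈ K}) (0, 0) (1, 1) := by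
    apply reach (E_convex hK x d)
    · rw [mem_ofPred_eq, E0]; exact hx
    · rw [mem_ofPred_eq, E1]; exact hy
    · exact good_of hK hi hQ x d hx (by simpa [hd] using hy) h0 h1
    · obtain ⟨t, ht, h⟩ := good_of hK hi hQ y (-d) hy (by simpa [hd] using hx)
        (by simpa using h0) (by simpa using h1)
      refine ⟨t, ht, ?_⟩
      have e : ∀ a b : ℝ, E y (-d) (a, b) = E x d (1 - a, 1 - b) := by
        intro a b
        apply ext2
        · simp [E_zero, d0]; ring
        · simp [E_one, d1]; ring
      simpa [e] using h
  obtain ⟨n, p, hp0, hpn, hp⟩ := path_of hr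
  have hmono : ∀ k, k < n → ∀ i, 0 ≤ d i * (E x d (p (k + 1)) i - E x d (p k) i) := by
    intro k hk i
    obtain ⟨_, _, h3, h4, _⟩ := hp k hk
    fin_cases i
    · simp only [Fin.zero_eta, E_zero]
      nlinarith [mul_nonneg (sub_nonneg.2 h3) (mul_self_nonneg (d 0))]
    · simp only [Fin.mk_one, E_one]
      nlinarith [mul_nonneg (sub_nonneg.2 h4) (mul_self_nonneg (d 1))]
  refine ⟨n, fun k => E x d (p k), by simp only [hp0, E0], by simp only [hpn, E1], ?_, ?_⟩
  · intro k hk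
    obtain ⟨m1, m2, h3, h4, h5⟩ := hp k hk
    refine ⟨?_, hK.segment_subset m1 m2⟩
    rcases h5 with h | h
    · refine ⟨1, fun j hj => ?_⟩
      fin_cases j
      · simp [E_zero, h]
      · exact absurd rfl hj
    · refine ⟨0, fun j hj => ?_⟩
      fin_cases j
      · exact absurd rfl hj
      · simp [E_one, h]
  · intro k hk l hl i _ _
    have hdi : 0 < d i * d i := by
      apply mul_self_pos.2
      fin_cases i
      · exact h0
      · exact h1
    have := mul_nonneg (hmono k hk i) (hmono l hl i)
    refine nonneg_of_mul_nonneg_right (a := d i * d i) ?_ hdi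
    calc _ ≤ _ := this
      _ = _ := by ring

/-- the arc -/
noncomputable def phi (a b : ℝ) (t : ℝ) : EucR 2 := !₂[a * Real.cos t, b * Real.sin t]

lemma phi_zero (a b t : ℝ) : phi a b t 0 = a * Real.cos t := by simp [phi]
lemma phi_one (a b t : ℝ) : phi a b t 1 = b * Real.sin t := by simp [phi]

lemma phi_norm {a b : ℝ} (ha : a * a = 1) (hb : b * b = 1) (t : ℝ) : ‖phi a b t‖ = 1 := by
  rw [EuclideanSpace.norm_eq, Fin.sum_univ_two]
  simp only [phi_zero, phi_one, Real.norm_eq_abs, sq_abs]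
  rw [show (a * Real.cos t) ^ 2 + (b * Real.sin t) ^ 2 = 1 by
    have := Real.sin_sq_add_cos_sq t
    calc _ = (a * a) * Real.cos t ^ 2 + (b * b) * Real.sin t ^ 2 := by ring
      _ = 1 := by rw [ha, hb]; linarith]
  simp

lemma phi_lip {a b : ℝ} (ha : a * a = 1) (hb : b * b = 1) : LipschitzWith 1 (phi a b) := by
  apply LipschitzWith.of_dist_le_mul
  intro s t
  rw [EuclideanSpace.dist_eq, Fin.sum_univ_two]
  simp only [phi_zero, phi_one, Real.dist_eq, sq_abs, NNReal.coe_one, one_mul]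
  rw [← Real.sqrt_sq_eq_abs (s - t)]
  apply Real.sqrt_le_sqrt
  have h1 := Real.sin_sq_add_cos_sq t
  have h2 := Real.sin_sq_add_cos_sq s
  have h3 := Real.one_sub_sq_div_two_le_cos (x := s - t)
  rw [Real.cos_sub] at h3
  calc _ = (a * a) * (Real.cos s - Real.cos t) ^ 2 + (b * b) * (Real.sin s - Real.sin t) ^ 2 := by
        ring
    _ ≤ _ := by rw [ha, hb]; nlinarith

lemma polar {a b : ℝ} (ha : a * a = 1) (hb : b * b = 1) (v : EucR 2) (h0 : 0 < a * v 0)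
    (h1 : 0 < b * v 1) : ∃ r t : ℝ, 0 < r ∧ t ∈ Ioo 0 (Real.pi / 2) ∧ v = r • phi a b t := by
  set t := Real.arctan (b * v 1 / (a * v 0)) with ht
  have hc : 0 < Real.cos t := Real.cos_arctan_pos _
  have htan : Real.tan t = b * v 1 / (a * v 0) := Real.tan_arctan _
  rw [Real.tan_eq_sin_div_cos, div_eq_div_iff hc.ne' h0.ne'] at htan
  refine ⟨a * v 0 / Real.cos t, t, div_pos h0 hc,
    ⟨Real.arctan_pos.2 (div_pos h1 h0), Real.arctan_lt_pi_div_two _⟩, ?_⟩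
  apply ext2
  · simp only [PiLp.smul_apply, phi_zero, smul_eq_mul]
    rw [div_mul_eq_mul_div, eq_div_iff hc.ne']
    linear_combination (-(v 0 * Real.cos t)) * ha
  · simp only [PiLp.smul_apply, phi_one, smul_eq_mul]
    rw [div_mul_eq_mul_div, eq_div_iff hc.ne']
    linear_combination (-(v 1 * Real.cos t)) * hb - b * htan

lemma obtuse_not {K : Set (EucR 2)} (hK : Convex ℝ K) {x : EucR 2} {a b : ℝ} (ha : a * a = 1)
    (hb : b * b = 1) (hx : x ∈ frontier K) (hob : Obtuse K)
    (hq : ∀ z ∈ K, z ≠ x → 0 < a * (z 0 - x 0) ∧ 0 < b * (z 1 - x 1)) : False := by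
  set S : Set ℝ := {t | t ∈ Ioo 0 (Real.pi / 2) ∧ ∃ r : ℝ, 0 < r ∧ x + r • phi a b t ∈ K} with hS
  have hpi := Real.pi_pos
  have hpol : ∀ z ∈ K, z ≠ x → ∃ r t : ℝ, 0 < r ∧ t ∈ S ∧ z - x = r • phi a b t := by
    intro z hz hne
    obtain ⟨q0, q1⟩ := hq z hz hne
    obtain ⟨r, t, hr, ht, e⟩ := polar ha hb (z - x) (by simpa using q0) (by simpa using q1)
    refine ⟨r, t, hr, ⟨ht, r, hr, ?_⟩, e⟩
    rw [← e]; simpa using hz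
  have hdir : dirSet x K ⊆ phi a b '' S := by
    rintro u ⟨y, hy, hne, rfl⟩
    obtain ⟨r, t, hr, ht, e⟩ := hpol y hy hne
    refine ⟨t, ht, ?_⟩
    rw [e, norm_smul, phi_norm ha hb, mul_one, Real.norm_eq_abs, abs_of_pos hr, smul_smul,
      inv_mul_cancel₀ hr.ne', one_smul]
  have hmeas : angMeasure x K ≤ volume S := by
    calc angMeasure x K ≤ μH[1] (phi a b '' S) := measure_mono hdir
      _ ≤ _ := ((phi_lip ha hb).lipschitzOnWith (s := S)).hausdorffMeasure_image_le zero_le_one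
      _ = volume S := by simp [hausdorffMeasure_real]
  have hSsub : S ⊆ Ioo 0 (Real.pi / 2) := fun t ht => ht.1
  have hvol : volume S ≤ ENNReal.ofReal (Real.pi / 2) := by
    calc volume S ≤ volume (Ioo 0 (Real.pi / 2)) := measure_mono hSsub
      _ = _ := by rw [Real.volume_Ioo, sub_zero]
  rcases hob x hx with h | ⟨h, hno⟩
  · exact absurd (h.trans_le (hmeas.trans hvol)) (lt_irrefl _)
  have hge : ENNReal.ofReal (Real.pi / 2) ≤ volume S := h ▸ hmeas
  have hbetween : ∀ t1 ∈ S, ∀ t2 ∈ S, ∀ t, t1 < t → t < t2 → t ∈ S := by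
    rintro t1 ⟨⟨p1, p1'⟩, r1, hr1, m1⟩ t2 ⟨⟨p2, p2'⟩, r2, hr2, m2⟩ t h1 h2
    have s1 : 0 < Real.sin (t2 - t) := Real.sin_pos_of_pos_of_lt_pi (by linarith) (by linarith)
    have s2 : 0 < Real.sin (t - t1) := Real.sin_pos_of_pos_of_lt_pi (by linarith) (by linarith)
    have s3 : 0 < Real.sin (t2 - t1) := Real.sin_pos_of_pos_of_lt_pi (by linarith) (by linarith)
    set A := Real.sin (t2 - t) / r1 with hA
    set B := Real.sin (t - t1) / r2 with hB
    have hA0 : 0 < A := by positivity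
    have hB0 : 0 < B := by positivity
    have eA : A * r1 = Real.sin (t2 - t) := by rw [hA]; field_simp
    have eB : B * r2 = Real.sin (t - t1) := by rw [hB]; field_simp
    have hAB : A + B ≠ 0 := by positivity
    refine ⟨⟨by linarith, by linarith⟩, Real.sin (t2 - t1) / (A + B), by positivity, ?_⟩
    have hm := hK m1 m2 (a := A / (A + B)) (b := B / (A + B)) (by positivity) (by positivity)
      (by field_simp)
    convert hm using 1
    have hsc := Real.sin_sq_add_cos_sq t
    apply ext2
    · simp only [PiLp.add_apply, PiLp.smul_apply, phi_zero, smul_eq_mul]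
      field_simp
      have : Real.sin (t2 - t1) * Real.cos t
          = A * r1 * Real.cos t1 + B * r2 * Real.cos t2 := by
        rw [eA, eB]; simp only [Real.sin_sub]; ring
      linear_combination a * this
    · simp only [PiLp.add_apply, PiLp.smul_apply, phi_one, smul_eq_mul]
      field_simp
      have : Real.sin (t2 - t1) * Real.sin t
          = A * r1 * Real.sin t1 + B * r2 * Real.sin t2 := by
        rw [eA, eB]; simp only [Real.sin_sub]; ring
      linear_combination b * this
  have hfull : ∀ t ∈ Ioo 0 (Real.pi / 2), t ∈ S := by
    rintro t ⟨ht0, ht1⟩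
    by_contra hn
    have hcase : S ⊆ Ioo 0 t ∨ S ⊆ Ioo t (Real.pi / 2) := by
      by_contra hc
      rw [not_or, not_subset, not_subset] at hc
      obtain ⟨⟨t2, h2, h2'⟩, ⟨t1, h1, h1'⟩⟩ := hc
      have g2 : t < t2 := by
        rcases lt_trichotomy t t2 with g | g | g
        · exact g
        · exact absurd (g ▸ h2) hn
        · exact absurd ⟨h2.1.1, g⟩ h2'
      have g1 : t1 < t := by
        rcases lt_trichotomy t t1 with g | g | g
        · exact absurd ⟨g, h1.1.2⟩ h1'
        · exact absurd (g ▸ h1) hn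
        · exact g
      exact hn (hbetween t1 h1 t2 h2 t g1 g2)
    rcases hcase with hc | hc
    · have := hge.trans (measure_mono hc)
      rw [Real.volume_Ioo, ENNReal.ofReal_le_ofReal_iff (by linarith)] at this
      linarith
    · have := hge.trans (measure_mono hc)
      rw [Real.volume_Ioo, ENNReal.ofReal_le_ofReal_iff (by linarith)] at this
      linarith
  apply hno
  have hT : TCone x K \ {x} = {z : EucR 2 | 0 < a * (z 0 - x 0)} ∩ {z | 0 < b * (z 1 - x 1)} := by
    ext z
    simp only [TCone, rayFrom, mem_sdiff, mem_iUnion, mem_ofPred_eq, mem_singleton_iff, mem_inter_iff,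
      exists_prop]
    constructor
    · rintro ⟨⟨y, ⟨hy, hyx⟩, t, ht, rfl⟩, hne⟩
      have ht' : 0 < t := by
        rcases ht.eq_or_lt with h | h
        · subst h; simp at hne
        · exact h
      obtain ⟨q0, q1⟩ := hq y hy hyx
      simp only [PiLp.add_apply, PiLp.smul_apply, PiLp.sub_apply, smul_eq_mul]
      constructor
      · have := mul_pos ht' q0
        calc (0 : ℝ) < _ := this
          _ = _ := by ring
      · have := mul_pos ht' q1
        calc (0 : ℝ) < _ := this
          _ = _ := by ring
    · rintro ⟨q0, q1⟩
      obtain ⟨r, t, hr, ht, e⟩ := polar ha hb (z - x) (by simpa using q0) (by simpa using q1)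
      obtain ⟨_, r', hr', hm⟩ := hfull t ht
      refine ⟨⟨x + r' • phi a b t, ⟨hm, ?_⟩, r / r', by positivity, ?_⟩, ?_⟩
      · intro hc
        rw [add_eq_left, smul_eq_zero] at hc
        rcases hc with hc | hc
        · exact hr'.ne' hc
        · have := phi_norm ha hb t
          rw [hc, norm_zero] at this
          exact zero_ne_one this
      · rw [add_sub_cancel_left, smul_smul, div_mul_cancel₀ _ hr'.ne', ← e]; abel
      · rintro rfl
        simp at q0
  rw [hT]
  apply IsOpen.inter
  · exact isOpen_lt continuous_const (by fun_prop)
  · exact isOpen_lt continuous_const (by fun_prop)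

lemma sgn {d : ℝ} (h : d ≠ 0) : ∃ a : ℝ, a * a = 1 ∧ ∀ u, 0 < d * u → 0 < a * u := by
  rcases h.lt_or_gt with h | h
  · exact ⟨-1, by norm_num, fun u hu => by nlinarith [neg_of_mul_pos_right hu h.le]⟩
  · exact ⟨1, by norm_num, fun u hu => by nlinarith [pos_of_mul_pos_right hu h.le]⟩

lemma hullNQ (n : ℕ) (A : Fin n → Set (EucR 2))
    (hA : ∀ i, IsConvexBody (A i)) (hob : ∀ i, Obtuse (A i)) :
    NQ (convexHull ℝ (⋃ i, A i)) := by
  intro x hx d h0 h1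
  by_contra hc
  push Not at hc
  have hc' : ∀ z ∈ convexHull ℝ (⋃ i, A i), z ≠ x →
      0 < d 0 * (z 0 - x 0) ∧ 0 < d 1 * (z 1 - x 1) := by
    intro z hz hne
    have := hc z hz hne
    tauto
  have hnn : ∀ z ∈ convexHull ℝ (⋃ i, A i), 0 ≤ d 0 * (z 0 - x 0) := by
    intro z hz
    by_cases h : z = x
    · simp [h]
    · exact (hc' z hz h).1.le
  have hext : x ∈ (convexHull ℝ (⋃ i, A i)).extremePoints ℝ := by
    refine ⟨hx, ?_⟩
    rintro p hp q hq ⟨s, t, hs, ht, hst, e⟩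
    by_contra hne
    have e0 : s * p 0 + t * q 0 = x 0 := by rw [← e]; simp
    have k1 := mul_pos hs (hc' p hp hne).1
    have k2 := mul_nonneg ht.le (hnn q hq)
    have : s * (d 0 * (p 0 - x 0)) + t * (d 0 * (q 0 - x 0)) = 0 := by
      linear_combination d 0 * e0 - d 0 * x 0 * hst
    linarith
  obtain ⟨i, hi⟩ := mem_iUnion.1 (extremePoints_convexHull_subset hext)
  have hsub : A i ⊆ convexHull ℝ (⋃ i, A i) :=
    (subset_iUnion A i).trans (subset_convexHull ℝ _)
  obtain ⟨a, ha, ha'⟩ := sgn h0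
  obtain ⟨b, hb, hb'⟩ := sgn h1
  have hfr : x ∈ frontier (A i) := by
    rw [(hA i).2.1.isClosed.frontier_eq]
    refine ⟨hi, fun hint => ?_⟩
    have hcont : Continuous fun t : ℝ => x + t • d := by fun_prop
    have hev : ∀ᶠ t in nhds (0 : ℝ), x + t • d ∈ A i := by
      apply hcont.continuousAt.eventually
      simpa using mem_interior_iff_mem_nhds.1 hint
    obtain ⟨e, he, hball⟩ := Metric.eventually_nhds_iff.1 hev
    have hm : x + (-(e / 2)) • d ∈ A i := by
      apply hball
      rw [Real.dist_eq, sub_zero, abs_neg, abs_of_pos (by linarith)]; linarith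
    have := hnn _ (hsub hm)
    simp at this
    nlinarith [mul_pos he (mul_self_pos.2 h0)]
  refine obtuse_not (hA i).1 ha hb hfr (hob i) ?_
  intro z hz hne
  obtain ⟨k0, k1⟩ := hc' z (hsub hz) hne
  exact ⟨ha' _ k0, hb' _ k1⟩

end StairAux

/-- The convex hull of a union of finitely many obtuse convex bodies in `ℝ²` is
staircase connected. -/
theorem staircaseConnected_convexHull_union_obtuse (n : ℕ) (A : Fin n → Set (EucR 2))
    (hA : ∀ i, IsConvexBody (A i)) (hob : ∀ i, Obtuse (A i)) :
    StaircaseConnected (convexHull ℝ (⋃ i, A i)) := by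
  rcases n with _ | n
  · intro x hx
    simp at hx
  · apply StairAux.stair (convex_convexHull ℝ _) _ (StairAux.hullNQ _ A hA hob)
    obtain ⟨w, hw⟩ := (hA 0).2.2
    exact ⟨w, interior_mono ((subset_iUnion A 0).trans (subset_convexHull ℝ _)) hw⟩
end

section
/- The convex hull of a union of finitely many obtuse convex bodies in ℝ² is itself obtuse. -/
open Set MeasureTheory Bornology
open scoped ENNReal

theorem aux_isCompact_hull_union {s t : Set (EucR 2)} (hs : IsCompact s) (hsc : Convex ℝ s)
    (ht : IsCompact (convexHull ℝ t)) : IsCompact (convexHull ℝ (s ∪ t)) := by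
  rcases s.eq_empty_or_nonempty with rfl | hs0
  · simpa using ht
  rcases t.eq_empty_or_nonempty with rfl | ht0
  · simpa [hsc.convexHull_eq] using hs
  rw [convexHull_union hs0 ht0, hsc.convexHull_eq]
  have h := ((hs.prod ht).prod (isCompact_Icc (a := (0:ℝ)) (b := 1))).image
    (f := fun p : (EucR 2 × EucR 2) × ℝ => (1 - p.2) • p.1.1 + p.2 • p.1.2) (by fun_prop)
  convert h using 1
  ext z
  simp only [mem_convexJoin, segment_eq_image, mem_image, mem_prod, Prod.exists]
  constructor
  · rintro ⟨a, ha, b, hb, θ, hθ, rfl⟩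
    exact ⟨a, b, θ, ⟨⟨ha, hb⟩, hθ⟩, rfl⟩
  · rintro ⟨a, b, θ, ⟨⟨ha, hb⟩, hθ⟩, rfl⟩
    exact ⟨a, ha, b, hb, θ, hθ, rfl⟩

theorem aux_isCompact_hull {n : ℕ} (A : Fin n → Set (EucR 2))
    (hA : ∀ i, IsConvexBody (A i)) : IsCompact (convexHull ℝ (⋃ i, A i)) := by
  have key : ∀ s : Finset (Fin n), IsCompact (convexHull ℝ (⋃ i ∈ s, A i)) := by
    intro s
    induction s using Finset.induction_on with
    | empty => simp
    | insert a s has ih =>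
      rw [Finset.set_biUnion_insert]
      exact aux_isCompact_hull_union (hA a).2.1 (hA a).1 ih
  simpa using key Finset.univ

/-- Projections do not increase one-dimensional measure. -/
theorem aux_volume_le (S : Set (EucR 2)) (v : EucR 2) (hv : ‖v‖ = 1) (I : Set ℝ)
    (h : I ⊆ (fun z => inner ℝ v z) '' S) : volume I ≤ μH[1] S := by
  have hl : LipschitzWith 1 (fun z : EucR 2 => inner ℝ v z) := by
    refine LipschitzWith.of_dist_le_mul fun a b => ?_
    rw [Real.dist_eq, ← inner_sub_right, dist_eq_norm]
    simpa [hv] using abs_real_inner_le_norm v (a - b)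
  have h2 := hl.hausdorffMeasure_image_le (d := 1) zero_le_one S
  rw [hausdorffMeasure_real] at h2
  calc volume I ≤ _ := measure_mono h
    _ ≤ _ := h2
    _ = _ := by simp

theorem aux_sphere_pos (W : Set (EucR 2)) (hW : IsOpen W) (u : EucR 2) (hu : ‖u‖ = 1)
    (huW : u ∈ W) : 0 < μH[1] (Metric.sphere (0 : EucR 2) 1 ∩ W) := by
  set v : EucR 2 := !₂[-u 1, u 0] with hvdef
  have hu2 : u 0 ^ 2 + u 1 ^ 2 = 1 := by
    have := EuclideanSpace.real_norm_sq_eq u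
    rw [hu, Fin.sum_univ_two] at this; linarith
  have hv : ‖v‖ = 1 := by
    rw [EuclideanSpace.norm_eq, Fin.sum_univ_two]
    simp [hvdef]; linarith
  set γ : ℝ → EucR 2 := fun t => √(1 - t ^ 2) • u + t • v with hγ
  have hcont : Continuous γ := by fun_prop
  have h0 : γ 0 = u := by simp [hγ]
  have hnhds : γ ⁻¹' W ∈ nhds (0:ℝ) :=
    hcont.continuousAt.preimage_mem_nhds (by rw [h0]; exact hW.mem_nhds huW)
  obtain ⟨ε, hε, hball⟩ := Metric.mem_nhds_iff.1 hnhds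
  set δ := min ε 1
  have hδ : 0 < δ := lt_min hε one_pos
  have := aux_volume_le (Metric.sphere (0 : EucR 2) 1 ∩ W) v hv (Ioo (-δ) δ) (by
    intro t ht
    have ht1 : |t| < δ := abs_lt.2 ht
    have ht2 : t ^ 2 ≤ 1 := by
      have : |t| ≤ 1 := ht1.le.trans (min_le_right _ _)
      rw [← sq_abs]; nlinarith [abs_nonneg t]
    have hsq : √(1 - t ^ 2) ^ 2 = 1 - t ^ 2 := Real.sq_sqrt (by linarith)
    refine ⟨γ t, ⟨?_, hball ?_⟩, ?_⟩
    · rw [mem_sphere_zero_iff_norm, EuclideanSpace.norm_eq, Fin.sum_univ_two]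
      simp only [hγ, hvdef, Real.norm_eq_abs, sq_abs, Real.sqrt_eq_one]
      simp
      linear_combination (√(1 - t ^ 2) ^ 2 + t ^ 2) * hu2 + hsq
    · simpa using ht1.trans_le (min_le_left _ _)
    · simp [hγ, hvdef, PiLp.inner_apply, Fin.sum_univ_two]
      linear_combination t * hu2)
  refine lt_of_lt_of_le ?_ this
  simp [hδ]

theorem aux_dirSet_mono {x : EucR 2} {K L : Set (EucR 2)} (h : K ⊆ L) :
    dirSet x K ⊆ dirSet x L := by
  rintro u ⟨y, hy, h1, h2⟩
  exact ⟨y, h hy, h1, h2⟩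

theorem aux_mem_TCone {x z : EucR 2} {K : Set (EucR 2)} :
    z ∈ TCone x K ↔ ∃ y ∈ K, y ≠ x ∧ ∃ t : ℝ, 0 ≤ t ∧ z = x + t • (y - x) := by
  simp only [TCone, rayFrom, mem_iUnion, mem_sdiff, mem_singleton_iff, mem_ofPred_eq]
  constructor
  · rintro ⟨y, ⟨h1, h2⟩, h3⟩; exact ⟨y, h1, h2, h3⟩
  · rintro ⟨y, h1, h2, h3⟩; exact ⟨y, ⟨h1, h2⟩, h3⟩

theorem aux_subset_TCone {x w : EucR 2} {K : Set (EucR 2)} (hw : w ∈ K) (hwx : w ≠ x) :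
    K ⊆ TCone x K := by
  intro y hy
  rw [aux_mem_TCone]
  by_cases h : y = x
  · exact ⟨w, hw, hwx, 0, le_rfl, by simp [h]⟩
  · exact ⟨y, hy, h, 1, zero_le_one, by simp⟩

theorem aux_TCone_convex {x : EucR 2} {K : Set (EucR 2)} (hK : Convex ℝ K) :
    Convex ℝ (TCone x K) := by
  intro p hp q hq a b ha hb hab
  rw [aux_mem_TCone] at hp hq
  obtain ⟨y, hy, hyx, s, hs, rfl⟩ := hp
  obtain ⟨z, hz, hzx, t, ht, rfl⟩ := hq
  have e : a • (x + s • (y - x)) + b • (x + t • (z - x))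
      = x + ((a * s) • (y - x) + (b * t) • (z - x)) := by
    have : b = 1 - a := by linarith
    subst this; module
  rw [e]
  have h1 : 0 ≤ a * s := mul_nonneg ha hs
  have h2 : 0 ≤ b * t := mul_nonneg hb ht
  rcases (add_nonneg h1 h2).eq_or_lt with h | h
  · have h3 : a * s = 0 := by linarith
    have h4 : b * t = 0 := by linarith
    rw [h3, h4, aux_mem_TCone]
    exact ⟨y, hy, hyx, 0, le_rfl, by simp⟩
  · set T := a * s + b * t with hT
    have hw : (a * s / T) • y + (b * t / T) • z ∈ K :=
      hK hy hz (by positivity) (by positivity) (by field_simp; exact hT.symm)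
    have e2 : T • ((a * s / T) • y + (b * t / T) • z - x)
        = (a * s) • (y - x) + (b * t) • (z - x) := by
      rw [smul_sub, smul_add, smul_smul, smul_smul, mul_div_cancel₀ _ h.ne',
        mul_div_cancel₀ _ h.ne', hT]
      module
    rw [← e2, aux_mem_TCone]
    by_cases hx : (a * s / T) • y + (b * t / T) • z = x
    · exact ⟨y, hy, hyx, 0, le_rfl, by simp [hx]⟩
    · exact ⟨_, hw, hx, T, h.le, rfl⟩

/-- A functional supporting a convex set at a non-interior point. -/
theorem aux_support {S : Set (EucR 2)} (hS : Convex ℝ S) (hi : (interior S).Nonempty)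
    {p : EucR 2} (hp : p ∉ interior S) :
    ∃ f : StrongDual ℝ (EucR 2), (∀ a ∈ interior S, f a < f p) ∧ ∀ a ∈ S, f a ≤ f p := by
  obtain ⟨f, hf⟩ := geometric_hahn_banach_open_point hS.interior isOpen_interior hp
  refine ⟨f, hf, fun a ha => ?_⟩
  have : closure (interior S) ⊆ {z | f z ≤ f p} :=
    closure_minimal (fun z hz => (hf z hz).le) (isClosed_le f.continuous continuous_const)
  apply this
  rw [hS.closure_interior_eq_closure_of_nonempty_interior hi]
  exact subset_closure ha

/-- Case 1: enlarging a non-open cone to an open one strictly increases the angle. -/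
theorem aux_strict {x : EucR 2} {A K : Set (EucR 2)} (hA : Convex ℝ A)
    (hi : (interior A).Nonempty) (hAK : A ⊆ K) (hopen : IsOpen (TCone x K \ {x}))
    (hnot : ¬ IsOpen (TCone x A \ {x})) :
    ∃ U, MeasurableSet U ∧ 0 < μH[1] U ∧ U ⊆ dirSet x K ∧ Disjoint (dirSet x A) U := by
  have hmono : TCone x A ⊆ TCone x K := by
    intro z; simp only [aux_mem_TCone]
    rintro ⟨y, hy, h⟩; exact ⟨y, hAK hy, h⟩
  rw [isOpen_iff_mem_nhds] at hnot
  push Not at hnot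
  obtain ⟨p, ⟨hpT, hpx⟩, hpn⟩ := hnot
  rw [mem_singleton_iff] at hpx
  have hpi : p ∉ interior (TCone x A) := by
    intro h
    exact hpn (Filter.inter_mem (mem_interior_iff_mem_nhds.1 h)
      (isOpen_compl_singleton.mem_nhds hpx))
  obtain ⟨y, hy, hyx, t, ht, hpe⟩ := aux_mem_TCone.1 hpT
  have hTi : (interior (TCone x A)).Nonempty :=
    hi.mono (interior_mono (aux_subset_TCone hy hyx))
  obtain ⟨f, hf1, hf2⟩ := aux_support (aux_TCone_convex hA) hTi hpi
  have hfy : f (y - x) * t = 0 := by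
    have a1 := hf2 (x + (0:ℝ) • (y - x)) (aux_mem_TCone.2 ⟨y, hy, hyx, 0, le_rfl, rfl⟩)
    have a2 := hf2 (x + (t + t) • (y - x))
      (aux_mem_TCone.2 ⟨y, hy, hyx, t + t, by linarith, rfl⟩)
    rw [hpe] at a1 a2
    simp only [map_add, map_smul, smul_eq_mul] at a1 a2
    linarith
  have hfp : f p = f x := by
    rw [hpe, map_add, map_smul, smul_eq_mul]; linarith
  have hW : IsOpen {u : EucR 2 | x + u ∈ TCone x K \ {x} ∧ 0 < f u} :=
    (hopen.preimage (by fun_prop : Continuous fun u : EucR 2 => x + u)).inter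
      (isOpen_lt continuous_const f.continuous)
  refine ⟨Metric.sphere 0 1 ∩ {u : EucR 2 | x + u ∈ TCone x K \ {x} ∧ 0 < f u},
    Metric.isClosed_sphere.measurableSet.inter hW.measurableSet, ?_, ?_, ?_⟩
  · obtain ⟨c, hc⟩ := hTi
    have hfc := hf1 c hc
    have hev : ∀ᶠ s in nhdsWithin (0:ℝ) (Ioi 0), p + s • (p - c) ∈ TCone x K \ {x} := by
      apply Filter.Eventually.filter_mono nhdsWithin_le_nhds
      have hc : Continuous fun s : ℝ => p + s • (p - c) := by fun_prop
      exact hc.continuousAt.preimage_mem_nhds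
        (hopen.mem_nhds (by simpa using ⟨hmono hpT, hpx⟩))
    obtain ⟨s, hs, hs0⟩ := (hev.and self_mem_nhdsWithin).exists
    set q := p + s • (p - c) with hq
    obtain ⟨hqT, hqx⟩ := hs
    rw [mem_singleton_iff] at hqx
    have hn : 0 < ‖q - x‖ := norm_pos_iff.2 (sub_ne_zero.2 hqx)
    refine aux_sphere_pos _ hW (‖q - x‖⁻¹ • (q - x)) ?_ ⟨⟨?_, ?_⟩, ?_⟩
    · rw [norm_smul, norm_inv, norm_norm, inv_mul_cancel₀ hn.ne']
    · obtain ⟨z, hz, hzx, r, hr, hze⟩ := aux_mem_TCone.1 hqT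
      refine aux_mem_TCone.2 ⟨z, hz, hzx, ‖q - x‖⁻¹ * r, by positivity, ?_⟩
      rw [mul_smul]; congr 2; rw [hze]; simp
    · simp [sub_eq_zero, hqx]
    · rw [map_smul, smul_eq_mul]
      refine mul_pos (by positivity) ?_
      rw [hq]; simp only [map_sub, map_add, map_smul, smul_eq_mul]
      have : 0 < s * (f p - f c) := mul_pos hs0 (by linarith)
      linarith
  · rintro u ⟨hu, ⟨huT, hux⟩, -⟩
    rw [mem_sphere_zero_iff_norm] at hu
    obtain ⟨z, hz, hzx, r, hr, hze⟩ := aux_mem_TCone.1 huT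
    have hue : u = r • (z - x) := add_left_cancel hze
    refine ⟨z, hz, hzx, ?_⟩
    have hn : 0 < ‖z - x‖ := norm_pos_iff.2 (sub_ne_zero.2 hzx)
    rw [hue, norm_smul, Real.norm_of_nonneg hr] at hu
    rw [hue]; congr 1; field_simp; exact hu
  · rw [Set.disjoint_left]
    rintro u ⟨z, hz, hzx, rfl⟩ ⟨-, -, hfu⟩
    have h1 := hf2 z (aux_subset_TCone hz hzx hz)
    have hn : 0 < ‖z - x‖ := norm_pos_iff.2 (sub_ne_zero.2 hzx)
    rw [map_smul, smul_eq_mul, map_sub] at hfu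
    have := pos_of_mul_pos_right hfu (by positivity)
    linarith

/-- Case 2: a frontier point that is not extreme has angle at least `2`. -/
theorem aux_nonextreme {x : EucR 2} {K : Set (EucR 2)} (hK : Convex ℝ K)
    (hi : (interior K).Nonempty) (hxK : x ∈ K) (hx : x ∉ interior K)
    (hex : x ∉ K.extremePoints ℝ) :
    ENNReal.ofReal (Real.pi / 2) < μH[1] (dirSet x K) := by
  rw [mem_extremePoints_iff_left] at hex
  push Not at hex
  obtain ⟨a, ha, b, hb, ⟨s, t, hs, ht, hst, hxe⟩, hax⟩ := hex hxK
  obtain ⟨f, hf1, hf2⟩ := aux_support hK hi hx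
  have hfa := hf2 a ha
  have hfb := hf2 b hb
  have hfe : s * f a + t * f b = f x := by
    rw [← hxe]; simp
  have hsum : s * (f x - f a) + t * (f x - f b) = 0 := by
    have : s = 1 - t := by linarith
    subst this
    linarith
  have hsa : 0 ≤ s * (f x - f a) := mul_nonneg hs.le (by linarith)
  have htb : 0 ≤ t * (f x - f b) := mul_nonneg ht.le (by linarith)
  have hfa' : f a = f x := by
    have h0 : s * (f x - f a) = 0 := by linarith
    have := (mul_eq_zero.1 h0).resolve_left hs.ne'
    linarith
  have hfb' : f b = f x := by
    have h0 : t * (f x - f b) = 0 := by linarith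
    have := (mul_eq_zero.1 h0).resolve_left ht.ne'
    linarith
  obtain ⟨c, hc⟩ := hi
  have hfc := hf1 c hc
  have hcK := interior_subset hc
  have hbx : t • (b - x) = -(s • (a - x)) := by
    have : s = 1 - t := by linarith
    subst this
    rw [← hxe]; module
  have hbne : b ≠ x := by
    rintro rfl
    rw [sub_self, smul_zero, eq_comm, neg_eq_zero, smul_eq_zero] at hbx
    rcases hbx with h | h
    · exact hs.ne' h
    · exact hax (sub_eq_zero.1 h)
  have hseg : ∀ d, d ≠ x → f d = f x → x ∉ segment ℝ d c := by
    rintro d hd hfd ⟨m, k, hm, hk, hmk, he⟩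
    have h1 : m * f d + k * f c = f x := by rw [← he]; simp
    have h2 : k = 0 := by
      have : k * (f x - f c) = 0 := by
        have : m = 1 - k := by linarith
        subst this; rw [hfd] at h1; linarith
      rcases mul_eq_zero.1 this with h | h
      · exact h
      · linarith
    have h3 : m = 1 := by linarith
    subst h2 h3
    exact hd (by simpa using he)
  set P := segment ℝ a c ∪ segment ℝ b c with hP
  have hPpre : IsPreconnected P :=
    IsPreconnected.union c (right_mem_segment ..) (right_mem_segment ..)
      (convex_segment a c).isPreconnected (convex_segment b c).isPreconnected
  have hPK : P ⊆ K := union_subset (hK.segment_subset ha hcK) (hK.segment_subset hb hcK)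
  have hPx : ∀ z ∈ P, z ≠ x := by
    rintro z (hz | hz) rfl
    · exact hseg a hax hfa' hz
    · exact hseg b hbne hfb' hz
  have hna : 0 < ‖a - x‖ := norm_pos_iff.2 (sub_ne_zero.2 hax)
  have hnb : 0 < ‖b - x‖ := norm_pos_iff.2 (sub_ne_zero.2 hbne)
  set e := ‖a - x‖⁻¹ • (a - x) with he
  have hen : ‖e‖ = 1 := by
    rw [he, norm_smul, norm_inv, norm_norm, inv_mul_cancel₀ hna.ne']
  set g : EucR 2 → ℝ := fun y => inner ℝ e (‖y - x‖⁻¹ • (y - x)) with hg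
  have hgc : ContinuousOn g P := by
    have h1 : ContinuousOn (fun y : EucR 2 => ‖y - x‖⁻¹) P :=
      ContinuousOn.inv₀ (by fun_prop)
        (fun z hz => (norm_pos_iff.2 (sub_ne_zero.2 (hPx z hz))).ne')
    have h2 : ContinuousOn (fun y : EucR 2 => ‖y - x‖⁻¹ • (y - x)) P :=
      h1.smul (by fun_prop)
    exact ContinuousOn.inner continuousOn_const h2
  have hga : g a = 1 := by
    simp only [hg]
    rw [← he, real_inner_self_eq_norm_sq, hen]; norm_num
  have hgb : g b = -1 := by
    have hbe : ‖b - x‖⁻¹ • (b - x) = -e := by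
      have h1 : b - x = -((s / t) • (a - x)) := by
        have : b - x = t⁻¹ • (t • (b - x)) := by
          rw [smul_smul, inv_mul_cancel₀ ht.ne', one_smul]
        rw [this, hbx, smul_neg, smul_smul, inv_mul_eq_div]
      rw [h1, norm_neg, norm_smul, Real.norm_of_nonneg (by positivity), smul_neg, smul_smul, he]
      congr 2
      field_simp
    simp only [hg]
    rw [hbe, inner_neg_right, real_inner_self_eq_norm_sq, hen]; norm_num
  have hsub : Icc (-1:ℝ) 1 ⊆ (fun z => inner ℝ e z) '' dirSet x K := by
    have := hPpre.intermediate_value (a := b) (b := a) (Or.inr (left_mem_segment ..))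
      (Or.inl (left_mem_segment ..)) hgc
    rw [hga, hgb] at this
    intro r hr
    obtain ⟨y, hy, hyr⟩ := this hr
    exact ⟨_, ⟨y, hPK hy, hPx y hy, rfl⟩, hyr⟩
  refine lt_of_lt_of_le ?_ (aux_volume_le _ e hen _ hsub)
  rw [Real.volume_Icc]
  exact (ENNReal.ofReal_lt_ofReal_iff (by norm_num)).2 (by linarith [Real.pi_lt_d2])

/-- The convex hull of a union of finitely many obtuse convex bodies in `ℝ²` is
itself an obtuse convex body. -/
theorem obtuse_convexHull_union_obtuse (n : ℕ) (hn : 0 < n) (A : Fin n → Set (EucR 2))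
    (hA : ∀ i, IsConvexBody (A i)) (hob : ∀ i, Obtuse (A i)) :
    IsConvexBody (convexHull ℝ (⋃ i, A i)) ∧ Obtuse (convexHull ℝ (⋃ i, A i)) := by
  have hAK : ∀ i, A i ⊆ convexHull ℝ (⋃ i, A i) := fun i =>
    (subset_iUnion A i).trans (subset_convexHull ℝ _)
  have hcomp := aux_isCompact_hull A hA
  have hconv : Convex ℝ (convexHull ℝ (⋃ i, A i)) := convex_convexHull ℝ _
  have hKint : (interior (convexHull ℝ (⋃ i, A i))).Nonempty :=
    (hA ⟨0, hn⟩).2.2.mono (interior_mono (hAK _))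
  refine ⟨⟨hconv, hcomp, hKint⟩, ?_⟩
  intro x hx
  rw [hcomp.isClosed.frontier_eq] at hx
  obtain ⟨hxK, hxi⟩ := hx
  by_cases hxA : x ∈ ⋃ i, A i
  · obtain ⟨i, hxi'⟩ := mem_iUnion.1 hxA
    have hfr : x ∈ frontier (A i) :=
      ⟨subset_closure hxi', fun h => hxi (interior_mono (hAK i) h)⟩
    have hle : angMeasure x (A i) ≤ angMeasure x (convexHull ℝ (⋃ i, A i)) :=
      measure_mono (aux_dirSet_mono (hAK i))
    rcases hob i x hfr with h | ⟨h, hno⟩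
    · exact Or.inl (h.trans_le hle)
    · rw [h] at hle
      rcases hle.lt_or_eq with h2 | h2
      · exact Or.inl h2
      · refine Or.inr ⟨h2.symm, fun hop => ?_⟩
        obtain ⟨U, hUm, hU0, hUK, hUd⟩ := aux_strict (hA i).1 (hA i).2.2 (hAK i) hop hno
        have h3 : angMeasure x (A i) + μH[1] U
            ≤ angMeasure x (convexHull ℝ (⋃ i, A i)) := by
          unfold angMeasure
          rw [← measure_union hUd hUm]
          exact measure_mono (union_subset (aux_dirSet_mono (hAK i)) hUK)
        rw [← h2, h] at h3
        exact absurd h3 (not_le.2 (ENNReal.lt_add_right ENNReal.ofReal_ne_top hU0.ne'))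
  · exact Or.inl (aux_nonextreme hconv hKint hxK hxi
      (fun h => hxA (extremePoints_convexHull_subset h)))
end
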